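/- arXiv:1605.00903 — 6 statements merged into one kernel-verified Lean document; each statement's English description precedes it below -/
import Mathlib

section
/- There is an absolute constant C > 0 such that the following holds. Let d ≥ 2 be even, q even with d | q and q ≤ n, and let M be the row-column independent symmetrization of A^{⊗q/d} for a random d-tensor A with i.i.d. entries uniform on {−1,+1}. Then for every positive integer p, 𝔼[Tr(M^p)] ≤ C^{pq} · n^{pq/4 + q/2} · p^{(1+1/(2d))pq} / q^{(1/4−1/(2d))pq}. -/
open scoped BigOperators

noncomputable section

/-- The ±1-valued tensor associated with a Boolean sign pattern. -/
def signT {n d : ℕ} (A : (Fin d → Fin n) → Bool) : (Fin d → Fin n) → ℝ :=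
  fun K => if A K then 1 else -1

/-- Expectation of `g` over a random order-`d` tensor with i.i.d. uniform ±1 entries. -/
def texp (n d : ℕ) (g : ((Fin d → Fin n) → ℝ) → ℝ) : ℝ :=
  (∑ A : (Fin d → Fin n) → Bool, g (signT A)) / (Fintype.card ((Fin d → Fin n) → Bool) : ℝ)

/-- Probability of event `P` over a random order-`d` tensor with i.i.d. uniform ±1 entries. -/
def tprob (n d : ℕ) (P : ((Fin d → Fin n) → ℝ) → Prop) : ℝ :=
  (Nat.card {A : (Fin d → Fin n) → Bool // P (signT A)} : ℝ) /
    (Fintype.card ((Fin d → Fin n) → Bool) : ℝ)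

/-- Operator (ℓ₂→ℓ₂) norm of a rectangular array, as the sup of `|uᵀ M v|` over unit vectors. -/
def opNorm {ι κ : Type*} [Fintype ι] [Fintype κ] (M : ι → κ → ℝ) : ℝ :=
  sSup {r : ℝ | ∃ (u : EuclideanSpace ℝ ι) (v : EuclideanSpace ℝ κ),
    ‖u‖ = 1 ∧ ‖v‖ = 1 ∧ r = |∑ i, ∑ j, u i * M i j * v j|}

/-- Largest eigenvalue of a symmetric array, as the sup of Rayleigh quotients. -/
def lamMax {ι : Type*} [Fintype ι] (M : ι → ι → ℝ) : ℝ :=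
  sSup {r : ℝ | ∃ y : EuclideanSpace ℝ ι, ‖y‖ = 1 ∧ r = ∑ i, ∑ j, y i * M i j * y j}

/-- Number of occurrences of `v` among the coordinates of the tuple `I`. -/
def cnt {n k : ℕ} (I : Fin k → Fin n) (v : Fin n) : ℕ :=
  (Finset.univ.filter fun ℓ => I ℓ = v).card

/-- The set `O(δ)` of tuples whose multi-index is `δ`. -/
def Oset (n k : ℕ) (δ : Fin n → ℕ) : Finset (Fin k → Fin n) :=
  Finset.univ.filter fun K => ∀ v, cnt K v = δ v

/-- The set of elements of `[n]` occurring among the coordinates of `I¹, …, Iᵖ`. -/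
def occSet {n h p : ℕ} (I : Fin p → Fin h → Fin n) : Finset (Fin n) :=
  Finset.univ.filter fun v => ∃ ℓ j, I ℓ j = v

/-- Membership in the class `𝒞(c¹,…,cˢ)`: there are exactly `s` distinct occurring
elements and the `k`-th smallest occurring element appears `c k ℓ` times in `Iˡ`. -/
def inC {n h p s : ℕ} (c : Fin s → Fin p → ℕ) (I : Fin p → Fin h → Fin n) : Prop :=
  ∃ hcard : (occSet I).card = s,
    ∀ (k : Fin s) (ℓ : Fin p),
      cnt (I ℓ) (((occSet I).orderIsoOfFin hcard k : Fin n)) = c k ℓ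

/-- Concatenation of two half-tuples of length `d/2` into a tuple of length `d` (`d` even). -/
def halfConcat {n : ℕ} (d : ℕ) (hd : d % 2 = 0) (K₁ K₂ : Fin (d / 2) → Fin n) :
    Fin d → Fin n :=
  fun t => if h : (t : ℕ) < d / 2 then K₁ ⟨t, h⟩
           else K₂ ⟨(t : ℕ) - d / 2, by have ht := t.isLt; omega⟩

/-- The position in `[q/2]` of the `r`-th entry of the `m`-th block of length `d/2`. -/
def blockIdx (d q : ℕ) (m : Fin (q / d)) (r : Fin (d / 2)) : Fin (q / 2) :=
  ⟨(m : ℕ) * (d / 2) + (r : ℕ), by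
    have hm : (m : ℕ) < q / d := m.isLt
    have hr : (r : ℕ) < d / 2 := r.isLt
    have h3 : q / d * (d / 2) ≤ q / 2 := by
      have h4 : q / d * d ≤ q := Nat.div_mul_le_self q d
      have h6 : q / d * (d / 2) * 2 ≤ q / d * d := by
        have h5 : d / 2 * 2 ≤ d := by omega
        calc q / d * (d / 2) * 2 = q / d * (d / 2 * 2) := by ring
          _ ≤ q / d * d := Nat.mul_le_mul (le_refl _) h5
      omega
    have h7 : ((m : ℕ) + 1) * (d / 2) ≤ q / d * (d / 2) :=
      Nat.mul_le_mul (by omega) (le_refl _)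
    have h8 : ((m : ℕ) + 1) * (d / 2) = (m : ℕ) * (d / 2) + d / 2 := by ring
    omega⟩

/-- Row-column independent symmetrization of `A^{⊗ q/d}`. -/
def rcSym (n d q : ℕ) (hd : d % 2 = 0) (A : (Fin d → Fin n) → ℝ)
    (I J : Fin (q / 2) → Fin n) : ℝ :=
  ((Nat.factorial (q / 2) : ℝ))⁻¹ ^ 2 *
    ∑ π : Equiv.Perm (Fin (q / 2)), ∑ σ : Equiv.Perm (Fin (q / 2)),
      ∏ m : Fin (q / d),
        A (halfConcat d hd (fun r => I (π (blockIdx d q m r)))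
            (fun r => J (σ (blockIdx d q m r))))

/-- `E(I¹,…,Iᵖ) = 𝔼[∏_ℓ M[Iˡ, Iˡ⁺¹]]` (cyclically). -/
def Efun (n d q p : ℕ) (hd : d % 2 = 0) (hp : p ≠ 0)
    (I : Fin p → Fin (q / 2) → Fin n) : ℝ :=
  haveI : NeZero p := ⟨hp⟩
  texp n d fun A => ∏ ℓ : Fin p, rcSym n d q hd A (I ℓ) (I (ℓ + 1))

/-- `Tr(M^p)` for the row-column independent symmetrization `M` of `A^{⊗ q/d}`. -/
def trMpow (n d q p : ℕ) (hd : d % 2 = 0) (hp : p ≠ 0)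
    (A : (Fin d → Fin n) → ℝ) : ℝ :=
  haveI : NeZero p := ⟨hp⟩
  ∑ I : Fin p → Fin (q / 2) → Fin n, ∏ ℓ : Fin p, rcSym n d q hd A (I ℓ) (I (ℓ + 1))

/-- `𝒯 = Σ_ℓ T_ℓ ⊗ T_ℓ`, where `T_ℓ` is the symmetrized `ℓ`-th slice of the 3-tensor `A`. -/
def calT (n : ℕ) (A : (Fin 3 → Fin n) → ℝ) (u v : Fin n × Fin n) : ℝ :=
  ∑ ℓ : Fin n,
    ((A ![ℓ, u.1, v.1] + A ![ℓ, v.1, u.1]) / 2) *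
    ((A ![ℓ, u.2, v.2] + A ![ℓ, v.2, u.2]) / 2)

/-- `T = 𝒯 - D`, where `D` is the restriction of `𝒯` to entries `[(i,i),(j,j)]`. -/
def Tmat (n : ℕ) (A : (Fin 3 → Fin n) → ℝ) (u v : Fin n × Fin n) : ℝ :=
  calT n A u v - (if u.1 = u.2 ∧ v.1 = v.2 then calT n A u v else 0)

/-- The position in `[q/2]` of the `r`-th entry of the `g`-th pair. -/
def pairIdx (q : ℕ) (g : Fin (q / 4)) (r : Fin 2) : Fin (q / 2) :=
  ⟨2 * (g : ℕ) + (r : ℕ), by have hg := g.isLt; have hr := r.isLt; omega⟩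

/-- `𝖠 = T^{⊗ q/4}` as a `[n]^{q/2} × [n]^{q/2}` array. -/
def bigA3 (n q : ℕ) (A : (Fin 3 → Fin n) → ℝ) (I J : Fin (q / 2) → Fin n) : ℝ :=
  ∏ g : Fin (q / 4),
    Tmat n A (I (pairIdx q g 0), I (pairIdx q g 1)) (J (pairIdx q g 0), J (pairIdx q g 1))

/-- The row-column symmetrized matrix `B`. -/
def Bmat (n q : ℕ) (A : (Fin 3 → Fin n) → ℝ) (I J : Fin (q / 2) → Fin n) : ℝ :=
  ((Nat.factorial (q / 2) : ℝ))⁻¹ ^ 2 *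
    ∑ π : Equiv.Perm (Fin (q / 2)), ∑ σ : Equiv.Perm (Fin (q / 2)),
      bigA3 n q A (fun t => I (π t)) (fun t => J (σ t))

/-- `E(I¹,…,Iᵖ) = 𝔼[∏_ℓ B[Iˡ, Iˡ⁺¹]]` (cyclically), for the 3-tensor case. -/
def E3fun (n q p : ℕ) (hp : p ≠ 0) (I : Fin p → Fin (q / 2) → Fin n) : ℝ :=
  haveI : NeZero p := ⟨hp⟩
  texp n 3 fun A => ∏ ℓ : Fin p, Bmat n q A (I ℓ) (I (ℓ + 1))

/-- Concatenation of two tuples of length `q/2` into a tuple of length `q` (`q` even). -/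
def tupConcat {n : ℕ} (q : ℕ) (hq : q % 2 = 0) (I J : Fin (q / 2) → Fin n) :
    Fin q → Fin n :=
  fun t => if h : (t : ℕ) < q / 2 then I ⟨t, h⟩
           else J ⟨(t : ℕ) - q / 2, by have ht := t.isLt; omega⟩

end

namespace RC

lemma sum_sign_prod {ι κ : Type*} [Fintype ι] [Fintype κ] [DecidableEq κ] (K : ι → κ) (c : κ)
    (hc : ¬ Even (Finset.univ.filter fun i => K i = c).card) :
    ∑ A : κ → Bool, ∏ i, (if A (K i) then (1 : ℝ) else -1) = 0 := by
  classical
  let φ : (κ → Bool) → (κ → Bool) := fun A => Function.update A c (!A c)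
  have hφ : Function.Involutive φ := by
    intro A
    ext k
    by_cases hk : k = c
    · subst hk; simp [φ]
    · simp [φ, hk]
  have h1 := Equiv.sum_comp (Function.Involutive.toPerm φ hφ) (fun A : κ → Bool => ∏ i, (if A (K i) then (1 : ℝ) else -1))
  have h2 : ∀ A : κ → Bool, ∏ i, (if ((Function.Involutive.toPerm φ hφ) A) (K i) then (1 : ℝ) else -1)
      = - ∏ i, (if A (K i) then (1 : ℝ) else -1) := by
    intro A
    have : ∀ i, (if ((Function.Involutive.toPerm φ hφ) A) (K i) then (1 : ℝ) else -1)
      = (if K i = c then (-1 : ℝ) else 1) * (if A (K i) then (1 : ℝ) else -1) := by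
      intro i
      simp only [Function.Involutive.coe_toPerm, φ]
      by_cases hk : K i = c
      · by_cases hA : A c = true <;> simp [hk, hA]
      · simp [hk]
    rw [Finset.prod_congr rfl (fun i _ => this i), Finset.prod_mul_distrib, Finset.prod_ite]
    simp only [Finset.prod_const, one_pow, mul_one]
    rw [(Nat.not_even_iff_odd.mp hc).neg_one_pow]
    simp
  rw [Finset.sum_congr rfl (fun A _ => h2 A), Finset.sum_neg_distrib] at h1
  linarith

lemma exists_pairing {ι κ : Type*} [Fintype ι] [Fintype κ] [DecidableEq κ] (K : ι → κ) (N : ℕ)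
    (hN : Fintype.card ι = 2 * N)
    (hK : ∀ c, Even (Finset.univ.filter fun i => K i = c).card) :
    ∃ e : Fin N × Bool ≃ ι, ∀ i, K (e (i, false)) = K (e (i, true)) := by
  classical
  choose m hm using hK
  have h1 : ∀ c, Nonempty (Fin (m c) × Bool ≃ {i // K i = c}) := by
    intro c
    refine ⟨Fintype.equivOfCardEq ?_⟩
    rw [Fintype.card_subtype, hm c]; simp; ring
  let f : ∀ c, Fin (m c) × Bool ≃ {i // K i = c} := fun c => (h1 c).some
  let e1 : (Σ c, Fin (m c) × Bool) ≃ ι := (Equiv.sigmaCongrRight f).trans (Equiv.sigmaFiberEquiv K)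
  let e2 : (Σ c, Fin (m c)) × Bool ≃ ι := (Equiv.sigmaProdDistrib (fun c => Fin (m c)) Bool).trans e1
  have h2 : ∀ s b, K (e2 (s, b)) = s.1 := by
    intro s b
    exact (f s.1 (s.2, b)).2
  have h3 : Fintype.card (Fin N) = Fintype.card (Σ c, Fin (m c)) := by
    have := Fintype.card_congr e2
    rw [Fintype.card_prod, Fintype.card_bool] at this
    rw [Fintype.card_fin]; omega
  let e3 := Fintype.equivOfCardEq h3
  refine ⟨(Equiv.prodCongr e3 (Equiv.refl Bool)).trans e2, fun i => ?_⟩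
  simp [h2]

lemma factorial_le_pairings {ι κ : Type*} [Fintype ι] [DecidableEq ι] [DecidableEq κ]
    (K : ι → κ) (N : ℕ)
    (e : Fin N × Bool ≃ ι) (he : ∀ i, K (e (i, false)) = K (e (i, true))) :
    N.factorial ≤ (Finset.univ.filter fun e : Fin N × Bool ≃ ι =>
      ∀ i, K (e (i, false)) = K (e (i, true))).card := by
  classical
  have h0 : N.factorial = (Finset.univ : Finset (Equiv.Perm (Fin N))).card := by
    rw [Finset.card_univ, Fintype.card_perm, Fintype.card_fin]
  rw [h0]
  refine Finset.card_le_card_of_injOn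
    (fun ρ => (Equiv.prodCongr ρ (Equiv.refl Bool)).trans e) ?_ ?_
  · intro ρ _
    simp [he]
  · intro ρ _ ρ' _ h
    ext i
    have := congrArg (fun g : Fin N × Bool ≃ ι => g (i, true)) h
    simp at this
    simp [this]

lemma texp_le {ι : Type*} [Fintype ι] [DecidableEq ι] (n d N : ℕ) (K : ι → Fin d → Fin n)
    (hN : Fintype.card ι = 2 * N) :
    texp n d (fun A => ∏ i, A (K i)) ≤ ((N.factorial : ℝ))⁻¹ *
      ∑ e : Fin N × Bool ≃ ι, if (∀ i, K (e (i, false)) = K (e (i, true))) then (1:ℝ) else 0 := by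
  classical
  by_cases hK : ∀ c, Even (Finset.univ.filter fun i => K i = c).card
  · obtain ⟨e, he⟩ := exists_pairing K N hN hK
    have h1 := factorial_le_pairings K N e he
    have h2 : texp n d (fun A => ∏ i, A (K i)) ≤ 1 := by
      unfold texp
      refine div_le_one_of_le₀ ?_ (by positivity)
      rw [← Finset.card_univ, Finset.cast_card]
      refine Finset.sum_le_sum fun A _ => ?_
      refine (le_abs_self _).trans ?_
      rw [Finset.abs_prod]
      refine (Finset.prod_congr rfl fun i _ => ?_).trans_le (le_of_eq (Finset.prod_const_one (ι := ι) (M := ℝ) (s := Finset.univ)))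
      unfold signT; split_ifs <;> simp
    refine h2.trans ?_
    rw [Finset.sum_boole, inv_mul_eq_div, le_div_iff₀ (by positivity), one_mul]
    exact_mod_cast h1
  · push Not at hK
    obtain ⟨c, hc⟩ := hK
    have : texp n d (fun A => ∏ i, A (K i)) = 0 := by
      unfold texp signT
      rw [sum_sign_prod K c hc, zero_div]
    rw [this]
    refine mul_nonneg (by positivity) (Finset.sum_nonneg fun e _ => ?_)
    split_ifs <;> simp

lemma texp_odd {ι : Type*} [Fintype ι] (n d : ℕ) (K : ι → Fin d → Fin n)
    (hN : ¬ Even (Fintype.card ι)) :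
    texp n d (fun A => ∏ i, A (K i)) = 0 := by
  classical
  by_cases hK : ∀ c, Even (Finset.univ.filter fun i => K i = c).card
  · exfalso
    apply hN
    rw [← Finset.card_univ, Finset.card_eq_sum_card_fiberwise (f := K) (t := Finset.univ) (by simp)]
    exact Finset.even_sum _ fun c _ => hK c
  · push Not at hK
    obtain ⟨c, hc⟩ := hK
    unfold texp signT
    rw [sum_sign_prod K c hc, zero_div]

lemma sum_prod_factorial (n a : ℕ) :
    ∑ Y : Fin a → Fin n, ∏ v, ((Finset.univ.filter fun x => Y x = v).card.factorial : ℝ)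
      ≤ ((n : ℝ) + a) ^ a := by
  induction a with
  | zero => simp
  | succ a ih =>
    rw [← Equiv.sum_comp (Fin.consEquiv (fun _ : Fin (a+1) => Fin n)), Fintype.sum_prod_type_right]
    have h : ∀ Y : Fin a → Fin n, ∑ w : Fin n, ∏ v,
        ((Finset.univ.filter fun x => (Fin.consEquiv (fun _ : Fin (a+1) => Fin n)) (w, Y) x = v).card.factorial : ℝ)
        = ((n : ℝ) + a) * ∏ v, ((Finset.univ.filter fun x => Y x = v).card.factorial : ℝ) := by
      intro Y
      have h1 : ∀ w : Fin n, ∏ v,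
        ((Finset.univ.filter fun x => (Fin.consEquiv (fun _ : Fin (a+1) => Fin n)) (w, Y) x = v).card.factorial : ℝ)
        = (((Finset.univ.filter fun x => Y x = w).card : ℝ) + 1) *
          ∏ v, ((Finset.univ.filter fun x => Y x = v).card.factorial : ℝ) := by
        intro w
        have h2 : ∀ v, ((Finset.univ.filter fun x => (Fin.consEquiv (fun _ : Fin (a+1) => Fin n)) (w, Y) x = v).card.factorial : ℝ)
          = (if v = w then (((Finset.univ.filter fun x => Y x = w).card : ℝ) + 1) else 1) *
            ((Finset.univ.filter fun x => Y x = v).card.factorial : ℝ) := by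
          intro v
          rw [Fin.card_filter_univ_succ]
          simp only [Fin.consEquiv_apply, Fin.cons_zero, Fin.cons_succ]
          by_cases hv : w = v
          · subst hv
            simp [Nat.factorial_succ]
          · simp [hv, Ne.symm hv]
        rw [Finset.prod_congr rfl fun v _ => h2 v, Finset.prod_mul_distrib]
        simp
      rw [Finset.sum_congr rfl fun w _ => h1 w, ← Finset.sum_mul, Finset.sum_add_distrib]
      congr 1
      have h3 := Finset.card_eq_sum_card_fiberwise (f := Y) (s := Finset.univ) (t := Finset.univ) (by simp)
      rw [Finset.card_univ, Fintype.card_fin] at h3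
      have h4 : (a : ℝ) = ∑ w : Fin n, ((Finset.univ.filter fun x => Y x = w).card : ℝ) := by
        exact_mod_cast h3
      rw [← h4]; simp; ring
    rw [Finset.sum_congr rfl fun Y _ => h Y, ← Finset.mul_sum, pow_succ']
    push_cast
    gcongr
    · linarith
    · refine ih.trans ?_
      gcongr
      linarith

lemma sum_prod_count {X : Type*} [Fintype X] [DecidableEq X] (n : ℕ) :
    ∑ Y : X → Fin n, ∏ x, ((Finset.univ.filter fun x' => Y x' = Y x).card : ℝ)
      ≤ (Real.exp 1) ^ (Fintype.card X) * ((n : ℝ) + Fintype.card X) ^ (Fintype.card X) := by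
  classical
  have h0 : ∀ m : ℕ, (m : ℝ) ^ m ≤ Real.exp 1 ^ m * m.factorial := by
    intro m
    have := Real.pow_div_factorial_le_exp (m : ℝ) (by positivity) m
    rw [div_le_iff₀ (by positivity)] at this
    rwa [← Real.exp_nat_mul, mul_one]
  have h1 : ∀ Y : X → Fin n, ∏ x, ((Finset.univ.filter fun x' => Y x' = Y x).card : ℝ)
      ≤ (Real.exp 1) ^ (Fintype.card X) *
        ∏ v, ((Finset.univ.filter fun x => Y x = v).card.factorial : ℝ) := by
    intro Y
    rw [← Finset.prod_fiberwise (s := Finset.univ) (g := Y)]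
    have h2 : ∀ v, ∏ x ∈ Finset.univ.filter (fun x => Y x = v), ((Finset.univ.filter fun x' => Y x' = Y x).card : ℝ)
       = ((Finset.univ.filter fun x => Y x = v).card : ℝ) ^ (Finset.univ.filter fun x => Y x = v).card := by
      intro v
      rw [← Finset.prod_const]
      refine Finset.prod_congr rfl fun x hx => ?_
      rw [(Finset.mem_filter.mp hx).2]
    have h3 := Finset.card_eq_sum_card_fiberwise (f := Y) (s := Finset.univ) (t := Finset.univ) (by simp)
    rw [Finset.card_univ] at h3
    rw [Finset.prod_congr rfl fun v _ => h2 v, h3, ← Finset.prod_pow_eq_pow_sum, ← Finset.prod_mul_distrib]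
    exact Finset.prod_le_prod (fun v _ => by positivity) fun v _ => h0 _
  refine (Finset.sum_le_sum fun Y _ => h1 Y).trans ?_
  rw [← Finset.mul_sum]
  refine mul_le_mul_of_nonneg_left ?_ (by positivity)
  refine le_trans (le_of_eq ?_) (sum_prod_factorial n (Fintype.card X))
  let ε := Fintype.equivFin X
  refine Fintype.sum_equiv (Equiv.arrowCongr ε (Equiv.refl _)) _ _ fun Y => ?_
  refine Finset.prod_congr rfl fun v _ => ?_
  congr 2
  refine Finset.card_equiv ε fun x => ?_
  simp

/-- For a fixed labelling, the number of column permutations compatible with the pairing. -/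
lemma count_sigma {X : Type*} [Fintype X] {p h n : ℕ}
    (e : X × Bool ≃ Fin p × Fin h) (s : Equiv.Perm (Fin p)) (I : Fin p → Fin h → Fin n)
    (u : X × Bool ≃ Fin p × Fin h)
    (hu : ∀ x, I (u (x, false)).1 (u (x, false)).2 = I (u (x, true)).1 (u (x, true)).2) :
    (Finset.univ.filter fun σ : Fin p → Equiv.Perm (Fin h) =>
      ∀ x, I (s (e (x, false)).1) (σ (e (x, false)).1 (e (x, false)).2) =
        I (s (e (x, true)).1) (σ (e (x, true)).1 (e (x, true)).2)).card
    ≤ (∏ x, (Finset.univ.filter fun w : Fin p × Fin h =>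
        I w.1 w.2 = I (u (x, false)).1 (u (x, false)).2).card) * h ^ Fintype.card X := by
  classical
  set cN : Fin n → ℕ := fun v => (Finset.univ.filter fun w : Fin p × Fin h => I w.1 w.2 = v).card with hcN
  set D := ∏ x, cN (I (u (x, false)).1 (u (x, false)).2) with hD
  have key : ∀ γ : X × Bool ≃ Fin p × Fin h,
      (∀ x, I (γ (x, false)).1 (γ (x, false)).2 = I (γ (x, true)).1 (γ (x, true)).2) →
      (∏ x, cN (I (γ (x, false)).1 (γ (x, false)).2)) ^ 2 = ∏ w : Fin p × Fin h, cN (I w.1 w.2) := by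
    intro γ hγ
    rw [← Equiv.prod_comp γ, Fintype.prod_prod_type, ← Finset.prod_pow]
    refine Finset.prod_congr rfl fun x _ => ?_
    rw [Fintype.prod_bool, hγ x, sq]
  have hcard : h ^ Fintype.card X = (Finset.univ : Finset (X → Fin h)).card := by simp
  rw [hcard]
  refine Finset.card_le_mul_card_image_of_maps_to
    (f := fun σ x => σ (e (x, false)).1 (e (x, false)).2) (fun _ _ => Finset.mem_univ _) D ?_
  intro g _
  rw [Finset.filter_filter]
  rcases Finset.eq_empty_or_nonempty (Finset.univ.filter fun σ : Fin p → Equiv.Perm (Fin h) =>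
      (∀ x, I (s (e (x, false)).1) (σ (e (x, false)).1 (e (x, false)).2) =
        I (s (e (x, true)).1) (σ (e (x, true)).1 (e (x, true)).2)) ∧
        (fun x => σ (e (x, false)).1 (e (x, false)).2) = g) with h0 | ⟨σ0, h0⟩
  · rw [h0]; simp
  · obtain ⟨h01, h02⟩ := (Finset.mem_filter.mp h0).2
    have hZ : ∏ x, cN (I (s (e (x, false)).1) (g x)) = D := by
      let γ : X × Bool ≃ Fin p × Fin h :=
        e.trans ((Equiv.prodShear (Equiv.refl _) σ0).trans (Equiv.prodCongr s (Equiv.refl _)))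
      have hγ : ∀ y, γ y = (s (e y).1, σ0 (e y).1 (e y).2) := fun y => rfl
      have h3 := key γ (by intro x; simpa only [hγ] using h01 x)
      have h4 := key u hu
      rw [← h4] at h3
      have h5 := Nat.pow_left_injective (n := 2) (by norm_num) h3
      rw [hD, ← h5]
      refine Finset.prod_congr rfl fun x _ => ?_
      rw [hγ, ← h02]
    rw [← hZ]
    have hpi : ∏ x, cN (I (s (e (x, false)).1) (g x)) = (Fintype.piFinset fun x =>
        Finset.univ.filter fun w : Fin p × Fin h => I w.1 w.2 = I (s (e (x, false)).1) (g x)).card := by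
      rw [Fintype.card_piFinset]
    rw [hpi]
    refine Finset.card_le_card_of_injOn
      (fun σ x => (s (e (x, true)).1, σ (e (x, true)).1 (e (x, true)).2)) ?_ ?_
    · intro σ hσ
      obtain ⟨h1, h2⟩ := (Finset.mem_filter.mp hσ).2
      simp only [Finset.mem_coe, Fintype.mem_piFinset, Finset.mem_filter, Finset.mem_univ, true_and]
      intro x
      rw [← h1 x, ← h2]
    · intro σ hσ σ' hσ' hh
      obtain ⟨_, h2⟩ := (Finset.mem_filter.mp hσ).2
      obtain ⟨_, h2'⟩ := (Finset.mem_filter.mp hσ').2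
      funext ℓ
      ext j
      obtain ⟨⟨x, b⟩, hy⟩ := e.surjective (ℓ, j)
      cases b
      · have := congrFun (h2.trans h2'.symm) x
        simp only [hy] at this
        rw [this]
      · have := congrFun hh x
        simp only [hy, Prod.mk.injEq, true_and] at this
        rw [this]

lemma count_total {X : Type*} [Fintype X] {p h n : ℕ}
    (e : X × Bool ≃ Fin p × Fin h) (s : Equiv.Perm (Fin p)) (π : Fin p → Equiv.Perm (Fin h)) :
    (∑ I : Fin p → Fin h → Fin n, ∑ σ : Fin p → Equiv.Perm (Fin h),
      if ((∀ x, I (e (x, false)).1 (π (e (x, false)).1 (e (x, false)).2) =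
        I (e (x, true)).1 (π (e (x, true)).1 (e (x, true)).2)) ∧
      (∀ x, I (s (e (x, false)).1) (σ (e (x, false)).1 (e (x, false)).2) =
        I (s (e (x, true)).1) (σ (e (x, true)).1 (e (x, true)).2))) then (1:ℝ) else 0)
    ≤ (2 * Real.exp 1 * h * ((n : ℝ) + Fintype.card X)) ^ Fintype.card X := by
  classical
  let u : X × Bool ≃ Fin p × Fin h := e.trans (Equiv.prodShear (Equiv.refl _) π)
  have hu : ∀ y, u y = ((e y).1, π (e y).1 (e y).2) := fun y => rfl
  let S := Finset.univ.filter fun I : Fin p → Fin h → Fin n =>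
    ∀ x, I (u (x, false)).1 (u (x, false)).2 = I (u (x, true)).1 (u (x, true)).2
  let Yf : (Fin p → Fin h → Fin n) → X → Fin n := fun I x => I (u (x, false)).1 (u (x, false)).2
  let F : (X → Fin n) → ℝ := fun Y => ∏ x, ((Finset.univ.filter fun x' => Y x' = Y x).card : ℝ)
  have h1 : ∀ I ∈ S, ∀ x, (Finset.univ.filter fun w : Fin p × Fin h =>
        I w.1 w.2 = I (u (x, false)).1 (u (x, false)).2).card
        = 2 * (Finset.univ.filter fun x' => Yf I x' = Yf I x).card := by
    intro I hI x
    have hI' := (Finset.mem_filter.mp hI).2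
    rw [Finset.card_filter, ← Equiv.sum_comp u, Fintype.sum_prod_type, Finset.card_filter, Finset.mul_sum]
    refine Finset.sum_congr rfl fun x' _ => ?_
    rw [Fintype.sum_bool, ← hI' x']
    simp only [Yf]
    ring
  calc _ ≤ ∑ I : Fin p → Fin h → Fin n, if I ∈ S then (2 * (h:ℝ)) ^ Fintype.card X * F (Yf I) else 0 := by
        refine Finset.sum_le_sum fun I _ => ?_
        split_ifs with hI
        · have hI' := (Finset.mem_filter.mp hI).2
          have h2 := count_sigma e s I u hI'
          refine le_trans (Finset.sum_le_sum (g := fun σ => if (∀ x, I (s (e (x, false)).1) (σ (e (x, false)).1 (e (x, false)).2) =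
            I (s (e (x, true)).1) (σ (e (x, true)).1 (e (x, true)).2)) then (1:ℝ) else 0) fun σ _ => ?_) ?_
          · by_cases hB : (∀ x, I (s (e (x, false)).1) (σ (e (x, false)).1 (e (x, false)).2) =
              I (s (e (x, true)).1) (σ (e (x, true)).1 (e (x, true)).2))
            · simp only [hB, implies_true, and_true, if_true]; split_ifs <;> simp
            · simp only [hB, and_false, if_false]; simp
          · rw [Finset.sum_boole]
            refine (Nat.cast_le.mpr h2).trans (le_of_eq ?_)
            rw [Finset.prod_congr rfl fun x _ => h1 I hI x]
            push_cast
            rw [Finset.prod_mul_distrib]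
            simp [F, mul_pow]
            ring
        · refine le_of_eq (Finset.sum_eq_zero fun σ _ => ?_)
          rw [if_neg]
          intro hc
          exact hI (Finset.mem_filter.mpr ⟨Finset.mem_univ _, hc.1⟩)
    _ = ∑ I ∈ S, (2 * (h:ℝ)) ^ Fintype.card X * F (Yf I) := by
        rw [Finset.sum_ite_mem, Finset.univ_inter]
    _ = (2 * (h:ℝ)) ^ Fintype.card X * ∑ I ∈ S, F (Yf I) := by rw [Finset.mul_sum]
    _ = (2 * (h:ℝ)) ^ Fintype.card X * ∑ Y ∈ S.image Yf, F Y := by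
        rw [Finset.sum_image]
        intro I hI I' hI' hh
        have hI1 := (Finset.mem_filter.mp hI).2
        have hI2 := (Finset.mem_filter.mp hI').2
        funext ℓ j
        obtain ⟨⟨x, b⟩, hy⟩ := u.surjective (ℓ, j)
        have h3 := congrFun hh x
        simp only [Yf] at h3
        cases b
        · simpa only [hy] using h3
        · rw [hI1, hI2] at h3
          simpa only [hy] using h3
    _ ≤ (2 * (h:ℝ)) ^ Fintype.card X * ∑ Y, F Y := by
        refine mul_le_mul_of_nonneg_left ?_ (by positivity)
        refine Finset.sum_le_sum_of_subset_of_nonneg (Finset.subset_univ _) fun Y _ _ => ?_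
        exact Finset.prod_nonneg fun x _ => by positivity
    _ ≤ (2 * (h:ℝ)) ^ Fintype.card X * ((Real.exp 1) ^ (Fintype.card X) * ((n : ℝ) + Fintype.card X) ^ (Fintype.card X)) := by
        exact mul_le_mul_of_nonneg_left (sum_prod_count n) (by positivity)
    _ = _ := by simp only [mul_pow]; ring

end RC

namespace RC

lemma texp_sum {ι : Type*} (s : Finset ι) (n d : ℕ) (f : ι → ((Fin d → Fin n) → ℝ) → ℝ) :
    texp n d (fun A => ∑ i ∈ s, f i A) = ∑ i ∈ s, texp n d (f i) := by
  unfold texp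
  rw [Finset.sum_comm, Finset.sum_div]

lemma texp_mul (n d : ℕ) (c : ℝ) (f : ((Fin d → Fin n) → ℝ) → ℝ) :
    texp n d (fun A => c * f A) = c * texp n d f := by
  unfold texp
  rw [← Finset.mul_sum, mul_div_assoc]

lemma halfConcat_inj {n d : ℕ} (hd : d % 2 = 0) {a b a' b' : Fin (d / 2) → Fin n}
    (h : halfConcat d hd a b = halfConcat d hd a' b') : a = a' ∧ b = b' := by
  constructor
  · funext r
    have := congrFun h ⟨r, by have := r.isLt; omega⟩
    simpa [halfConcat] using this
  · funext r
    have := congrFun h ⟨d / 2 + r, by have := r.isLt; omega⟩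
    simpa [halfConcat] using this

lemma blockIdx_inj {d q : ℕ} {m m' : Fin (q / d)} {r r' : Fin (d / 2)}
    (h : blockIdx d q m r = blockIdx d q m' r') : m = m' ∧ r = r' := by
  have h1 : (m : ℕ) * (d / 2) + r = m' * (d / 2) + r' := by
    simpa [blockIdx] using h
  have hr := r.isLt
  have hr' := r'.isLt
  have h2 : (r : ℕ) = r' := by
    have := congrArg (· % (d / 2)) h1
    simpa [Nat.mul_add_mod', Nat.mod_eq_of_lt hr, Nat.mod_eq_of_lt hr'] using this
  have h3 : (m : ℕ) * (d / 2) = m' * (d / 2) := by omega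
  have h4 : (m : ℕ) = m' := Nat.eq_of_mul_eq_mul_right (by omega) h3
  exact ⟨Fin.ext h4, Fin.ext h2⟩

/-- The pairing of positions induced by a pairing of blocks. -/
lemma exists_posPairing {p d q N : ℕ} (hde : d % 2 = 0) (hdq : d ∣ q)
    (hN : p * (q / d) = 2 * N) (e : Fin N × Bool ≃ Fin p × Fin (q / d)) :
    ∃ e' : (Fin N × Fin (d / 2)) × Bool ≃ Fin p × Fin (q / 2),
      ∀ i r b, e' ((i, r), b) = ((e (i, b)).1, blockIdx d q (e (i, b)).2 r) := by
  let f : (Fin N × Fin (d / 2)) × Bool → Fin p × Fin (q / 2) :=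
    fun y => ((e (y.1.1, y.2)).1, blockIdx d q (e (y.1.1, y.2)).2 y.1.2)
  have hf : Function.Bijective f := by
    rw [Fintype.bijective_iff_injective_and_card]
    constructor
    · rintro ⟨⟨i, r⟩, b⟩ ⟨⟨i', r'⟩, b'⟩ h
      simp only [f, Prod.mk.injEq] at h
      obtain ⟨h1, h2⟩ := h
      obtain ⟨h3, h4⟩ := blockIdx_inj h2
      have := e.injective (Prod.ext h1 h3)
      simp only [Prod.mk.injEq] at this
      simp [this, h4]
    · simp only [Fintype.card_prod, Fintype.card_fin, Fintype.card_bool]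
      obtain ⟨k, rfl⟩ := hdq
      obtain ⟨t, rfl⟩ : ∃ t, d = 2 * t := ⟨d / 2, by omega⟩
      rcases Nat.eq_zero_or_pos t with rfl | ht
      · simp
      · rw [Nat.mul_div_cancel_left _ (by omega)] at hN
        have h1 : 2 * t * k / 2 = t * k := by
          rw [mul_assoc, Nat.mul_div_cancel_left _ (by omega)]
        have h2 : 2 * t / 2 = t := Nat.mul_div_cancel_left _ (by omega)
        rw [h1, h2]
        calc N * t * 2 = (2 * N) * t := by ring
          _ = p * (t * k) := by rw [← hN]; ring
  exact ⟨Equiv.ofBijective f hf, fun i r b => rfl⟩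

lemma trMpow_expand (n d q p : ℕ) [NeZero p] (hde : d % 2 = 0) (hp : p ≠ 0) (A : (Fin d → Fin n) → ℝ) :
    trMpow n d q p hde hp A = ((((q / 2).factorial : ℝ))⁻¹ ^ 2) ^ p *
      ∑ π : Fin p → Equiv.Perm (Fin (q / 2)), ∑ I : Fin p → Fin (q / 2) → Fin n,
        ∑ σ : Fin p → Equiv.Perm (Fin (q / 2)),
        ∏ y : Fin p × Fin (q / d), A (halfConcat d hde (fun r => I y.1 (π y.1 (blockIdx d q y.2 r)))
            (fun r => I (y.1 + 1) (σ y.1 (blockIdx d q y.2 r)))) := by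
  unfold trMpow rcSym
  rw [Finset.sum_comm, Finset.mul_sum]
  refine Finset.sum_congr rfl fun I _ => ?_
  rw [Finset.prod_mul_distrib, Finset.prod_const, Finset.card_univ, Fintype.card_fin,
    Finset.prod_univ_sum, Fintype.piFinset_univ]
  congr 1
  refine Finset.sum_congr rfl fun π _ => ?_
  rw [Finset.prod_univ_sum, Fintype.piFinset_univ]
  refine Finset.sum_congr rfl fun σ _ => ?_
  rw [Fintype.prod_prod_type]

lemma texp_trMpow (n d q p : ℕ) [NeZero p] (hde : d % 2 = 0) (hp : p ≠ 0) :
    texp n d (trMpow n d q p hde hp) = ((((q / 2).factorial : ℝ))⁻¹ ^ 2) ^ p *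
      ∑ π : Fin p → Equiv.Perm (Fin (q / 2)), ∑ I : Fin p → Fin (q / 2) → Fin n,
        ∑ σ : Fin p → Equiv.Perm (Fin (q / 2)),
        texp n d fun A => ∏ y : Fin p × Fin (q / d), A (halfConcat d hde (fun r => I y.1 (π y.1 (blockIdx d q y.2 r)))
            (fun r => I (y.1 + 1) (σ y.1 (blockIdx d q y.2 r)))) := by
  rw [funext (trMpow_expand n d q p hde hp), texp_mul, texp_sum]
  simp only [texp_sum]

lemma main_bound (n d q p N : ℕ) [NeZero p] (hde : d % 2 = 0) (hp : p ≠ 0) (hdq : d ∣ q)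
    (hN : p * (q / d) = 2 * N) :
    texp n d (trMpow n d q p hde hp) ≤
      ((((q / 2).factorial : ℝ))⁻¹) ^ p * ((2 * N : ℕ) : ℝ) ^ N *
       (2 * Real.exp 1 * (q / 2 : ℕ) * ((n : ℝ) + (N * (d / 2) : ℕ))) ^ (N * (d / 2)) := by
  classical
  rw [texp_trMpow]
  set W := (2 * Real.exp 1 * (q / 2 : ℕ) * ((n : ℝ) + (N * (d / 2) : ℕ))) ^ (N * (d / 2)) with hW
  have hcard : Fintype.card (Fin p × Fin (q / d)) = 2 * N := by simp [hN]
  have h1 : ∀ π : Fin p → Equiv.Perm (Fin (q / 2)), (∑ I : Fin p → Fin (q / 2) → Fin n,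
        ∑ σ : Fin p → Equiv.Perm (Fin (q / 2)),
        texp n d fun A => ∏ y : Fin p × Fin (q / d), A (halfConcat d hde (fun r => I y.1 (π y.1 (blockIdx d q y.2 r)))
            (fun r => I (y.1 + 1) (σ y.1 (blockIdx d q y.2 r))))) ≤
        ((2 * N : ℕ) : ℝ) ^ N * W := by
    intro π
    calc _ ≤ ∑ I : Fin p → Fin (q / 2) → Fin n, ∑ σ : Fin p → Equiv.Perm (Fin (q / 2)),
          ((N.factorial : ℝ))⁻¹ * ∑ e : Fin N × Bool ≃ Fin p × Fin (q / d),
            if (∀ i, (fun y : Fin p × Fin (q / d) => halfConcat d hde (fun r => I y.1 (π y.1 (blockIdx d q y.2 r)))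
            (fun r => I (y.1 + 1) (σ y.1 (blockIdx d q y.2 r)))) (e (i, false)) =
             (fun y : Fin p × Fin (q / d) => halfConcat d hde (fun r => I y.1 (π y.1 (blockIdx d q y.2 r)))
            (fun r => I (y.1 + 1) (σ y.1 (blockIdx d q y.2 r)))) (e (i, true))) then (1:ℝ) else 0 :=
          Finset.sum_le_sum fun I _ => Finset.sum_le_sum fun σ _ => texp_le n d N _ hcard
      _ = ((N.factorial : ℝ))⁻¹ * ∑ e : Fin N × Bool ≃ Fin p × Fin (q / d),
          ∑ I : Fin p → Fin (q / 2) → Fin n, ∑ σ : Fin p → Equiv.Perm (Fin (q / 2)),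
            if (∀ i, (fun y : Fin p × Fin (q / d) => halfConcat d hde (fun r => I y.1 (π y.1 (blockIdx d q y.2 r)))
            (fun r => I (y.1 + 1) (σ y.1 (blockIdx d q y.2 r)))) (e (i, false)) =
             (fun y : Fin p × Fin (q / d) => halfConcat d hde (fun r => I y.1 (π y.1 (blockIdx d q y.2 r)))
            (fun r => I (y.1 + 1) (σ y.1 (blockIdx d q y.2 r)))) (e (i, true))) then (1:ℝ) else 0 := by
          simp_rw [← Finset.mul_sum]
          congr 1
          rw [Finset.sum_comm]
          rw [Finset.sum_congr rfl fun σ _ => Finset.sum_comm]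
          rw [Finset.sum_comm]
          exact Finset.sum_congr rfl fun e _ => Finset.sum_comm
      _ ≤ ((N.factorial : ℝ))⁻¹ * ∑ e : Fin N × Bool ≃ Fin p × Fin (q / d), W := by
          refine mul_le_mul_of_nonneg_left (Finset.sum_le_sum fun e _ => ?_) (by positivity)
          obtain ⟨e', he'⟩ := exists_posPairing hde hdq hN e
          have h2 := count_total (n := n) e' (Equiv.addRight (1 : Fin p)) π
          rw [Fintype.card_prod, Fintype.card_fin, Fintype.card_fin] at h2
          refine le_trans (Finset.sum_le_sum fun I _ => Finset.sum_le_sum fun σ _ => ?_) h2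
          split_ifs with hA hB
          · exact le_rfl
          · exfalso
            apply hB
            constructor
            · rintro ⟨i, r⟩
              have := congrFun (halfConcat_inj hde (hA i)).1 r
              simpa only [he'] using this
            · rintro ⟨i, r⟩
              have := congrFun (halfConcat_inj hde (hA i)).2 r
              simpa only [he', Equiv.coe_addRight] using this
          · exact zero_le_one
          · exact le_rfl
      _ ≤ ((2 * N : ℕ) : ℝ) ^ N * W := by
          have hW0 : 0 ≤ W := by rw [hW]; positivity
          have h3 : Fintype.card (Fin N × Bool ≃ Fin p × Fin (q / d)) ≤ (2 * N).factorial := by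
            by_cases hne : Nonempty (Fin N × Bool ≃ Fin p × Fin (q / d))
            · rw [Fintype.card_equiv hne.some]
              simp [mul_comm]
            · rw [not_nonempty_iff] at hne
              simp
          have h4 : (2 * N).factorial ≤ N.factorial * (2 * N) ^ N := by
            have := Nat.factorial_mul_descFactorial (n := 2 * N) (k := N) (by omega)
            rw [← this, show 2 * N - N = N by omega]
            exact Nat.mul_le_mul le_rfl (Nat.descFactorial_le_pow _ _)
          rw [Finset.sum_const, Finset.card_univ, nsmul_eq_mul, ← mul_assoc]
          refine mul_le_mul_of_nonneg_right ?_ hW0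
          rw [inv_mul_le_iff₀ (by positivity)]
          exact_mod_cast h3.trans h4
  refine (mul_le_mul_of_nonneg_left (Finset.sum_le_sum fun π _ => h1 π) (by positivity)).trans ?_
  rw [Finset.sum_const, Finset.card_univ, nsmul_eq_mul, Fintype.card_fun, Fintype.card_perm,
    Fintype.card_fin, Fintype.card_fin]
  have hf : ((q / 2).factorial : ℝ) ≠ 0 := by positivity
  push_cast
  apply le_of_eq
  rw [← pow_mul, mul_comm 2 p, pow_mul, sq]
  simp only [inv_pow]
  field_simp

lemma main_odd (n d q p : ℕ) [NeZero p] (hde : d % 2 = 0) (hp : p ≠ 0)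
    (hN : ¬ Even (p * (q / d))) :
    texp n d (trMpow n d q p hde hp) = 0 := by
  rw [texp_trMpow]
  rw [Finset.sum_eq_zero, mul_zero]
  intro π _
  refine Finset.sum_eq_zero fun I _ => Finset.sum_eq_zero fun σ _ => ?_
  apply texp_odd
  simpa using hN

end RC

namespace RC

lemma numeric (n d q p N : ℕ) (hd2 : 2 ≤ d) (hde : d % 2 = 0) (hdq : d ∣ q) (hqn : q ≤ n)
    (hp : 1 ≤ p) (hN : p * (q / d) = 2 * N) :
    ((((q / 2).factorial : ℝ))⁻¹) ^ p * ((2 * N : ℕ) : ℝ) ^ N *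
       (2 * Real.exp 1 * (q / 2 : ℕ) * ((n : ℝ) + (N * (d / 2) : ℕ))) ^ (N * (d / 2)) ≤
    (216 : ℝ) ^ (p * q) * (n : ℝ) ^ ((p : ℝ) * (q : ℝ) / 4 + (q : ℝ) / 2) *
          (p : ℝ) ^ ((1 + 1 / (2 * (d : ℝ))) * ((p : ℝ) * (q : ℝ))) /
          (q : ℝ) ^ ((1 / 4 - 1 / (2 * (d : ℝ))) * ((p : ℝ) * (q : ℝ))) := by
  rcases Nat.eq_zero_or_pos q with rfl | hq
  · have : N = 0 := by simpa using hN.symm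
    subst this
    simp
  obtain ⟨k, rfl⟩ := hdq
  obtain ⟨t, rfl⟩ : ∃ t, d = 2 * t := ⟨d / 2, by omega⟩
  have ht : 1 ≤ t := by omega
  have hk : 1 ≤ k := Nat.pos_of_mul_pos_left hq
  rw [Nat.mul_div_cancel_left _ (by omega)] at hN
  have e1 : 2 * t * k / 2 = t * k := by
    rw [mul_assoc, Nat.mul_div_cancel_left _ (by omega)]
  have e2 : 2 * t / 2 = t := Nat.mul_div_cancel_left _ (by omega)
  rw [e1, e2]
  set h := t * k with hh
  set X := N * t with hX
  have hh1 : 1 ≤ h := Nat.mul_pos ht hk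
  have hq2 : 2 * t * k = 2 * h := by rw [hh]; ring
  rw [hq2] at hqn ⊢
  have h2X : h * p = 2 * X := by
    rw [hh, hX]
    calc t * k * p = (p * k) * t := by ring
      _ = 2 * (N * t) := by rw [hN]; ring
  have hn1 : 1 ≤ n := by omega
  have hnR : (1 : ℝ) ≤ n := by exact_mod_cast hn1
  have hpR : (1 : ℝ) ≤ p := by exact_mod_cast hp
  have hhR : (1 : ℝ) ≤ h := by exact_mod_cast hh1
  have h2XR : (h : ℝ) * p = 2 * X := by exact_mod_cast h2X
  have hNR : (p : ℝ) * k = 2 * N := by exact_mod_cast hN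
  have htR : (1 : ℝ) ≤ t := by exact_mod_cast ht
  have hhtk : (h : ℝ) = t * k := by rw [hh]; push_cast; ring
  -- exponents
  have x1 : (p : ℝ) * ((2 * h : ℕ) : ℝ) / 4 + ((2 * h : ℕ) : ℝ) / 2 = (X : ℝ) + h := by
    push_cast; linarith
  have x0 : 1 / (2 * ((2 * t : ℕ) : ℝ)) * ((p : ℝ) * ((2 * h : ℕ) : ℝ)) = N := by
    push_cast
    rw [hhtk]
    field_simp
    linarith
  have x2 : (1 + 1 / (2 * ((2 * t : ℕ) : ℝ))) * ((p : ℝ) * ((2 * h : ℕ) : ℝ)) =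
      ((p * (2 * h) + N : ℕ) : ℝ) := by
    rw [add_mul, x0]; push_cast; ring
  have x3 : (1 / 4 - 1 / (2 * ((2 * t : ℕ) : ℝ))) * ((p : ℝ) * ((2 * h : ℕ) : ℝ)) =
      (X : ℝ) - N := by
    rw [sub_mul, x0]; push_cast; linarith
  rw [x1, x2, x3]
  have hq0 : (0 : ℝ) < ((2 * h : ℕ) : ℝ) := by positivity
  have y1 : (n : ℝ) ^ ((X : ℝ) + h) = (n : ℝ) ^ X * (n : ℝ) ^ h := by
    rw [Real.rpow_add (by positivity), Real.rpow_natCast, Real.rpow_natCast]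
  have y3 : ((2 * h : ℕ) : ℝ) ^ ((X : ℝ) - N) = ((2 * h : ℕ) : ℝ) ^ X / ((2 * h : ℕ) : ℝ) ^ N := by
    rw [Real.rpow_sub hq0, Real.rpow_natCast, Real.rpow_natCast]
  rw [y1, Real.rpow_natCast, y3]
  -- upper bounds
  have z1 : (((h.factorial : ℝ))⁻¹) ^ p ≤ ((Real.exp 1 / h) ^ 2) ^ X := by
    have a1 := Real.pow_div_factorial_le_exp (h : ℝ) (by positivity) h
    have a2 : ((h.factorial : ℝ))⁻¹ ≤ (Real.exp 1 / h) ^ h := by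
      rw [div_pow, ← Real.exp_nat_mul, mul_one, le_div_iff₀ (by positivity), inv_mul_eq_div]
      exact a1
    refine (pow_le_pow_left₀ (by positivity) a2 p).trans (le_of_eq ?_)
    rw [← pow_mul, ← pow_mul, h2X]
  have z2 : ((2 * N : ℕ) : ℝ) ^ N ≤ ((p : ℝ) * ((2 * h : ℕ) : ℝ)) ^ N := by
    refine pow_le_pow_left₀ (by positivity) ?_ N
    rw [← hN]
    push_cast
    rw [hhtk]
    have : (k : ℝ) ≤ 2 * (t * k) := by nlinarith [(Nat.cast_nonneg k : (0:ℝ) ≤ k)]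
    gcongr
  have z3 : (n : ℝ) + (X : ℕ) ≤ 2 * p * n := by
    have : (h : ℝ) * 2 ≤ n := by exact_mod_cast (by omega : h * 2 ≤ n)
    nlinarith
  have hexp : Real.exp 1 ^ 3 ≤ 27 := by
    have := Real.exp_one_lt_d9
    calc Real.exp 1 ^ 3 ≤ 3 ^ 3 := pow_le_pow_left₀ (by positivity) (by linarith) 3
      _ = 27 := by norm_num
  have z4 : (Real.exp 1 / h) ^ 2 * (2 * Real.exp 1 * (h : ℕ) * ((n : ℝ) + (X : ℕ)))
      ≤ 216 * p * n / ((2 * h : ℕ) : ℝ) := by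
    calc (Real.exp 1 / h) ^ 2 * (2 * Real.exp 1 * (h : ℕ) * ((n : ℝ) + (X : ℕ)))
        ≤ (Real.exp 1 / h) ^ 2 * (2 * Real.exp 1 * (h : ℕ) * (2 * p * n)) := by gcongr
      _ = 8 * Real.exp 1 ^ 3 * p * n / ((2 * h : ℕ) : ℝ) := by
          push_cast; field_simp; ring
      _ ≤ 8 * 27 * p * n / ((2 * h : ℕ) : ℝ) := by gcongr
      _ = _ := by norm_num
  calc _ ≤ ((Real.exp 1 / h) ^ 2) ^ X * ((p : ℝ) * ((2 * h : ℕ) : ℝ)) ^ N *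
        (2 * Real.exp 1 * (h : ℕ) * ((n : ℝ) + (X : ℕ))) ^ X := by gcongr
    _ = ((p : ℝ) * ((2 * h : ℕ) : ℝ)) ^ N *
        ((Real.exp 1 / h) ^ 2 * (2 * Real.exp 1 * (h : ℕ) * ((n : ℝ) + (X : ℕ)))) ^ X := by
          rw [mul_pow ((Real.exp 1 / h) ^ 2)]; ring
    _ ≤ ((p : ℝ) * ((2 * h : ℕ) : ℝ)) ^ N * (216 * p * n / ((2 * h : ℕ) : ℝ)) ^ X := by gcongr
    _ = (216 ^ X * ((n : ℝ) ^ X * 1) * (p : ℝ) ^ (X + N)) /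
        (((2 * h : ℕ) : ℝ) ^ X / ((2 * h : ℕ) : ℝ) ^ N) := by
          rw [div_pow, mul_pow, mul_pow, mul_pow, pow_add]
          field_simp
    _ ≤ _ := by
          have b1 : X ≤ p * (2 * h) := by nlinarith
          gcongr
          · norm_num
          · exact one_le_pow₀ hnR

end RC

theorem stmt_3 : ∃ C : ℝ, 0 < C ∧
    ∀ (n d q p : ℕ) (hd2 : 2 ≤ d) (hde : d % 2 = 0) (hqe : q % 2 = 0)
      (hdq : d ∣ q) (hqn : q ≤ n) (hp : 1 ≤ p),
      texp n d (trMpow n d q p hde (by omega)) ≤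
        C ^ (p * q) * (n : ℝ) ^ ((p : ℝ) * (q : ℝ) / 4 + (q : ℝ) / 2) *
          (p : ℝ) ^ ((1 + 1 / (2 * (d : ℝ))) * ((p : ℝ) * (q : ℝ))) /
          (q : ℝ) ^ ((1 / 4 - 1 / (2 * (d : ℝ))) * ((p : ℝ) * (q : ℝ))) := by
  refine ⟨216, by norm_num, ?_⟩
  intro n d q p hd2 hde hqe hdq hqn hp
  haveI : NeZero p := ⟨by omega⟩
  rcases Nat.even_or_odd (p * (q / d)) with hev | hodd
  · obtain ⟨N, hN⟩ := hev
    have hN : p * (q / d) = 2 * N := by omega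
    exact (RC.main_bound n d q p N hde (by omega) hdq hN).trans
      (RC.numeric n d q p N hd2 hde hdq hqn hp hN)
  · rw [RC.main_odd n d q p hde (by omega) (Nat.not_even_iff_odd.mpr hodd)]
    positivity
end

section
/- There is an absolute constant C > 0 such that the following holds. Let d ≥ 2 be even, q even with d | q, p a positive integer, and let M be the row-column independent symmetrization of A^{⊗q/d} for a random d-tensor A with i.i.d. entries uniform on {−1,+1}. For any s ≥ 1, any c^1,…,c^s ∈ {0,1,…,q/2}^p, and any (I^1,…,I^p) ∈ 𝒞(c^1,…,c^s), one has E(I^1,…,I^p) ≤ C^{pq} · p^{(1/2+1/(2d))pq} / q^{(1/2−1/(2d))pq} · ∏_{ℓ=1}^p (c^1_ℓ! · c^2_ℓ! ⋯ c^s_ℓ!). -/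
open scoped BigOperators

section helpers
open Finset

lemma arr_card {S ι : Type*} [Fintype S] [DecidableEq S] [Fintype ι] [DecidableEq ι]
    (C : ι → ℕ) (𝒢 : Finset (S → ι))
    (h𝒢 : ∀ G ∈ 𝒢, ∀ v, (univ.filter fun s => G s = v).card = C v) :
    𝒢.card * ∏ v, (C v).factorial ≤ Fintype.card S ^ Fintype.card S := by
  classical
  rcases 𝒢.eq_empty_or_nonempty with h | ⟨G0, h0⟩
  · simp [h]
  have hsum : ∑ v, C v = Fintype.card S := by
    rw [← Finset.card_univ, Finset.card_eq_sum_card_fiberwise (f := G0) (t := univ) (by simp)]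
    exact Finset.sum_congr rfl fun v _ => (h𝒢 G0 h0 v).symm
  calc 𝒢.card * ∏ v, (C v).factorial = ∑ G ∈ 𝒢, ∏ v, (C v).factorial := by simp
    _ ≤ ∑ G ∈ 𝒢, ∏ s, C (G s) := by
        refine Finset.sum_le_sum fun G hG => ?_
        rw [← Finset.prod_fiberwise univ G]
        refine Finset.prod_le_prod' fun v _ => ?_
        have : ∏ i with G i = v, C (G i) = C v ^ C v := by
          rw [Finset.prod_congr rfl (g := fun _ => C v) (by intro x hx; simp at hx; rw [hx])]
          rw [Finset.prod_const, h𝒢 G hG]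
        rw [this]
        exact Nat.factorial_le_pow _
    _ ≤ ∑ G : S → ι, ∏ s, C (G s) := Finset.sum_le_univ_sum_of_nonneg (by simp)
    _ = ∏ s : S, ∑ v, C v := (Fintype.prod_sum (fun (_ : S) v => C v)).symm
    _ = _ := by simp [hsum]

lemma half_set {B K : Type*} [Fintype B] [DecidableEq B] [Fintype K] [DecidableEq K]
    (κ : B → K) (he : ∀ k, Even (univ.filter fun x => κ x = k).card) :
    ∃ H : Finset B, (∀ w : K → ℕ, 2 * ∑ x ∈ H, w (κ x) = ∑ x, w (κ x)) ∧
      ∀ y, ∃ x ∈ H, κ x = κ y := by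
  classical
  have h1 : ∀ k, ∃ t ⊆ (univ.filter fun x => κ x = k),
      2 * t.card = (univ.filter fun x => κ x = k).card := by
    intro k
    obtain ⟨r, hr⟩ := he k
    obtain ⟨t, ht, htc⟩ := Finset.exists_subset_card_eq (s := univ.filter fun x => κ x = k) (n := r)
      (by omega)
    exact ⟨t, ht, by omega⟩
  choose t ht htc using h1
  have hf : ∀ k, ((univ.filter fun x => x ∈ t (κ x)).filter fun x => κ x = k) = t k := by
    intro k
    ext x
    simp only [mem_filter, mem_univ, true_and]
    constructor
    · rintro ⟨h, rfl⟩; exact h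
    · intro h
      have := ht k h
      simp at this
      subst this
      exact ⟨h, rfl⟩
  refine ⟨univ.filter fun x => x ∈ t (κ x), ?_, ?_⟩
  · intro w
    rw [← Finset.sum_fiberwise _ κ, ← Finset.sum_fiberwise univ κ, Finset.mul_sum]
    refine Finset.sum_congr rfl fun k _ => ?_
    rw [hf]
    rw [Finset.sum_congr rfl (g := fun _ => w k)
      (by intro x hx; have := ht k hx; simp at this; rw [this])]
    rw [Finset.sum_congr (s₁ := univ.filter fun x => κ x = k) rfl (g := fun _ => w k)
      (by intro x hx; simp at hx; rw [hx])]
    simp only [sum_const, smul_eq_mul]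
    rw [← htc k]; ring
  · intro y
    have : (univ.filter fun x => κ x = κ y).card ≠ 0 :=
      (Finset.card_pos.mpr ⟨y, by simp⟩).ne'
    have h2 : (t (κ y)).Nonempty := by
      rw [← Finset.card_pos]; have := htc (κ y); omega
    obtain ⟨x, hx⟩ := h2
    have h3 := ht _ hx
    simp at h3
    exact ⟨x, by simp [h3, hx], h3⟩

lemma count_main {W B : Type*} [Fintype W] [DecidableEq W] [Fintype B] [DecidableEq B]
    (n d : ℕ) (κ : W → B → (Fin d → Fin n)) (C : Fin n → ℕ) (D S : ℕ)
    (hS : 2 * S = Fintype.card B * d) (hd : 0 < d)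
    (hC : ∀ w v, ∑ x, (univ.filter fun r => κ w x r = v).card = 2 * C v)
    (hD : ∀ w0, (univ.filter fun w => κ w = κ w0).card ≤ D) :
    (univ.filter fun w => ∀ k, Even (univ.filter fun x => κ w x = k).card).card
        * ∏ v, (C v).factorial ≤
      2 ^ Fintype.card B * (Fintype.card B ^ (Fintype.card B / 2) * (D * S ^ S)) := by
  classical
  let T : (H : Finset B) → ({y // y ∈ Hᶜ} → B) → Finset W := fun H ψ => univ.filter fun w =>
    (∀ v, ∑ x ∈ H, (univ.filter fun r => κ w x r = v).card = C v) ∧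
      ∀ y, ψ y ∈ H ∧ κ w (ψ y) = κ w y
  let 𝓗 : Finset (Finset B) := univ.filter fun H => 2 * H.card = Fintype.card B
  have hsub : (univ.filter fun w => ∀ k, Even (univ.filter fun x => κ w x = k).card) ⊆
      𝓗.biUnion fun H => univ.biUnion fun ψ => T H ψ := by
    intro w hw
    simp only [mem_filter, mem_univ, true_and] at hw
    obtain ⟨H, hH, hψ⟩ := half_set (κ w) hw
    choose ψ hψ1 hψ2 using hψ
    simp only [mem_biUnion, mem_univ, true_and]
    refine ⟨H, ?_, fun y => ψ y, ?_⟩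
    · simp only [𝓗, mem_filter, mem_univ, true_and]
      simpa using hH (fun _ => 1)
    · simp only [T, mem_filter, mem_univ, true_and]
      refine ⟨fun v => ?_, fun y => ⟨hψ1 _, hψ2 _⟩⟩
      have h1 := hH (fun k => (univ.filter fun r => k r = v).card)
      have h2 := hC w v
      omega
  have hT : ∀ H ∈ 𝓗, ∀ ψ, (T H ψ).card * ∏ v, (C v).factorial ≤ D * S ^ S := by
    intro H hH ψ
    simp only [𝓗, mem_filter, mem_univ, true_and] at hH
    let ρ : W → ({x // x ∈ H} × Fin d → Fin n) := fun w z => κ w z.1 z.2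
    have h1 : (T H ψ).card ≤ D * ((T H ψ).image ρ).card := by
      refine Finset.card_le_mul_card_image _ _ ?_
      intro b hb
      obtain ⟨w0, hw0, rfl⟩ := Finset.mem_image.mp hb
      refine le_trans (Finset.card_le_card ?_) (hD w0)
      intro w hw
      simp only [mem_filter, mem_univ, true_and, T] at hw hw0 ⊢
      have hon : ∀ x ∈ H, κ w x = κ w0 x := by
        intro x hx
        funext r
        exact congrFun hw.2 (⟨x, hx⟩, r)
      funext x
      by_cases hx : x ∈ H
      · exact hon x hx
      · have hx' : x ∈ Hᶜ := by simpa using hx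
        have a := hw.1.2 ⟨x, hx'⟩
        have b := hw0.2 ⟨x, hx'⟩
        rw [← a.2, ← b.2]
        exact hon _ a.1
    have hcard : Fintype.card ({x // x ∈ H} × Fin d) = S := by
      rw [Fintype.card_prod, Fintype.card_coe, Fintype.card_fin]
      rw [← hH] at hS
      nlinarith
    have h2 := arr_card C ((T H ψ).image ρ) (by
      intro G hG v
      obtain ⟨w, hw, rfl⟩ := Finset.mem_image.mp hG
      simp only [mem_filter, mem_univ, true_and, T] at hw
      rw [← hw.1 v]
      simp only [Finset.card_filter, ρ]
      rw [Fintype.sum_prod_type]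
      exact Finset.sum_coe_sort H (fun x => ∑ r, if κ w x r = v then 1 else 0))
    rw [hcard] at h2
    calc _ ≤ (D * ((T H ψ).image ρ).card) * ∏ v, (C v).factorial := Nat.mul_le_mul_right _ h1
      _ = D * (((T H ψ).image ρ).card * ∏ v, (C v).factorial) := by ring
      _ ≤ _ := Nat.mul_le_mul_left _ h2
  have hHc : ∀ H ∈ 𝓗, (univ.biUnion fun ψ => T H ψ).card * ∏ v, (C v).factorial ≤
      Fintype.card B ^ (Fintype.card B / 2) * (D * S ^ S) := by
    intro H hH
    refine le_trans (Nat.mul_le_mul_right _ Finset.card_biUnion_le) ?_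
    rw [Finset.sum_mul]
    refine le_trans (Finset.sum_le_sum fun ψ _ => hT H hH ψ) ?_
    simp only [𝓗, mem_filter, mem_univ, true_and] at hH
    rw [Finset.sum_const, Finset.card_univ, Fintype.card_fun, Fintype.card_coe, Finset.card_compl,
      smul_eq_mul]
    have : Fintype.card B - H.card = Fintype.card B / 2 := by omega
    rw [this]
  refine le_trans (Nat.mul_le_mul_right _ (le_trans (Finset.card_le_card hsub)
    Finset.card_biUnion_le)) ?_
  rw [Finset.sum_mul]
  refine le_trans (Finset.sum_le_sum fun H hH => hHc H hH) ?_
  rw [Finset.sum_const, smul_eq_mul]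
  refine Nat.mul_le_mul_right _ ?_
  refine le_trans (Finset.card_le_univ _) ?_
  simp

lemma stab_card {α ι : Type*} [Fintype α] [DecidableEq α] [Fintype ι] [DecidableEq ι]
    (f G : α → ι) :
    (univ.filter fun g : Equiv.Perm α => f ∘ g = G).card ≤
      ∏ i, ((univ.filter fun a => f a = i).card).factorial := by
  classical
  rcases (univ.filter fun g : Equiv.Perm α => f ∘ g = G).eq_empty_or_nonempty with h | ⟨g0, h0⟩
  · simp [h]
  simp only [mem_filter, mem_univ, true_and] at h0
  have h1 := DomMulAct.stabilizer_card f
  simp only [Fintype.card_subtype] at h1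
  rw [← h1]
  refine Finset.card_le_card_of_injOn (fun g => g * g0⁻¹) ?_ ?_
  · intro g hg
    simp only [coe_filter, mem_univ, true_and, Set.mem_ofPred_eq] at hg ⊢
    funext a
    have := congrFun (hg.trans h0.symm) (g0⁻¹ a)
    simpa using this
  · intro a _ b _ hab
    exact mul_right_cancel hab

lemma texp_prod {B : Type*} [Fintype B] [DecidableEq B] (n d : ℕ) (κ : B → (Fin d → Fin n)) :
    texp n d (fun A => ∏ x, A (κ x)) ≤
      if ∀ k, Even (univ.filter fun x => κ x = k).card then 1 else 0 := by
  classical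
  unfold texp
  have hprod : ∀ A : (Fin d → Fin n) → Bool, ∏ x, signT A (κ x) =
      ∏ k, (if A k then (1:ℝ) else -1) ^ (univ.filter fun x => κ x = k).card := by
    intro A
    rw [← Finset.prod_fiberwise univ κ]
    refine Finset.prod_congr rfl fun k _ => ?_
    rw [← Finset.prod_const]
    refine Finset.prod_congr rfl fun x hx => ?_
    simp at hx
    simp [signT, hx]
  simp only [hprod]
  have hs := Fintype.prod_sum (fun (k : Fin d → Fin n) (b : Bool) =>
    (if b then (1:ℝ) else -1) ^ (univ.filter fun x => κ x = k).card)
  rw [← hs]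
  split_ifs with h
  · have : ∀ k, ∑ b : Bool, (if b then (1:ℝ) else -1) ^ (univ.filter fun x => κ x = k).card = 2 := by
      intro k
      simp [(h k).neg_one_pow]; try norm_num
    simp only [this]
    simp
  · push Not at h
    obtain ⟨k, hk⟩ := h
    have : ∏ k, ∑ b : Bool, (if b then (1:ℝ) else -1) ^ (univ.filter fun x => κ x = k).card = 0 := by
      refine Finset.prod_eq_zero (Finset.mem_univ k) ?_
      rw [Nat.not_even_iff_odd] at hk
      simp [hk.neg_one_pow]
    rw [this]; simp

end helpers

section helpers2
open Finset

/-- The tensor key attached to each box. -/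
def keyOf (n d q p : ℕ) [NeZero p] (hd : d % 2 = 0) (I : Fin p → Fin (q / 2) → Fin n)
    (w : Fin p → Equiv.Perm (Fin (q / 2)) × Equiv.Perm (Fin (q / 2)))
    (x : Fin p × Fin (q / d)) : Fin d → Fin n :=
  halfConcat d hd (fun r => I x.1 ((w x.1).1 (blockIdx d q x.2 r)))
    (fun r => I (x.1 + 1) ((w x.1).2 (blockIdx d q x.2 r)))

lemma halfConcat_left {n d : ℕ} (hd : d % 2 = 0) (K₁ K₂ : Fin (d / 2) → Fin n) (r : Fin (d / 2)) :
    halfConcat d hd K₁ K₂ ⟨r, by omega⟩ = K₁ r := by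
  simp [halfConcat]

lemma halfConcat_right {n d : ℕ} (hd : d % 2 = 0) (K₁ K₂ : Fin (d / 2) → Fin n) (r : Fin (d / 2)) :
    halfConcat d hd K₁ K₂ ⟨d / 2 + r, by omega⟩ = K₂ r := by
  simp [halfConcat]

lemma halfConcat_count {n d : ℕ} (hd : d % 2 = 0) (K₁ K₂ : Fin (d / 2) → Fin n) (v : Fin n) :
    (univ.filter fun r => halfConcat d hd K₁ K₂ r = v).card =
      (univ.filter fun r => K₁ r = v).card + (univ.filter fun r => K₂ r = v).card := by
  simp only [Finset.card_filter]
  rw [← Equiv.sum_comp (finSumFinEquiv.trans (finCongr (show d / 2 + d / 2 = d by omega)))]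
  rw [Fintype.sum_sum_type]
  congr 1
  · refine Finset.sum_congr rfl fun r _ => ?_
    rw [← halfConcat_left hd K₁ K₂ r]; rfl
  · refine Finset.sum_congr rfl fun r _ => ?_
    rw [← halfConcat_right hd K₁ K₂ r]; rfl

lemma block_arith {d q : ℕ} (hd : d % 2 = 0) (hdq : d ∣ q) : q / d * (d / 2) = q / 2 := by
  obtain ⟨b, rfl⟩ := hdq
  obtain ⟨e, rfl⟩ : ∃ e, d = 2 * e := ⟨d / 2, by omega⟩
  rcases Nat.eq_zero_or_pos e with rfl | he
  · simp
  · rw [Nat.mul_div_cancel_left _ (by omega), Nat.mul_div_cancel_left _ (by omega), mul_assoc,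
      Nat.mul_div_cancel_left _ (by omega), mul_comm]

/-- Blocks enumerate all positions. -/
def blockEquiv (d q : ℕ) (hd : d % 2 = 0) (hdq : d ∣ q) :
    Fin (q / d) × Fin (d / 2) ≃ Fin (q / 2) :=
  finProdFinEquiv.trans (finCongr (block_arith hd hdq))

lemma blockEquiv_apply (d q : ℕ) (hd : d % 2 = 0) (hdq : d ∣ q) (m : Fin (q / d))
    (r : Fin (d / 2)) : blockEquiv d q hd hdq (m, r) = blockIdx d q m r := by
  apply Fin.ext
  simp [blockEquiv, blockIdx, finProdFinEquiv_apply_val]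
  ring

lemma block_count {n d q : ℕ} (hd : d % 2 = 0) (hdq : d ∣ q) (J : Fin (q / 2) → Fin n)
    (π : Equiv.Perm (Fin (q / 2))) (v : Fin n) :
    ∑ m, (univ.filter fun r => J (π (blockIdx d q m r)) = v).card = cnt J v := by
  unfold cnt
  simp only [Finset.card_filter]
  rw [← Equiv.sum_comp π, ← Equiv.sum_comp (blockEquiv d q hd hdq), Fintype.sum_prod_type]
  simp only [blockEquiv_apply]

lemma key_count (n d q p : ℕ) [NeZero p] (hd : d % 2 = 0) (hdq : d ∣ q)
    (I : Fin p → Fin (q / 2) → Fin n)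
    (w : Fin p → Equiv.Perm (Fin (q / 2)) × Equiv.Perm (Fin (q / 2))) (v : Fin n) :
    ∑ x, (univ.filter fun r => keyOf n d q p hd I w x r = v).card = 2 * ∑ ℓ, cnt (I ℓ) v := by
  rw [Finset.sum_congr rfl fun x _ => halfConcat_count hd
    (fun r => I x.1 ((w x.1).1 (blockIdx d q x.2 r)))
    (fun r => I (x.1 + 1) ((w x.1).2 (blockIdx d q x.2 r))) v]
  rw [Fintype.sum_prod_type]
  simp only [Finset.sum_add_distrib, block_count hd hdq]
  have := Equiv.sum_comp (Equiv.addRight (1 : Fin p)) (fun ℓ => cnt (I ℓ) v)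
  simp only [Equiv.coe_addRight] at this
  rw [this, two_mul]

lemma key_fiber (n d q p : ℕ) [NeZero p] (hd : d % 2 = 0) (hdq : d ∣ q)
    (I : Fin p → Fin (q / 2) → Fin n)
    (w0 : Fin p → Equiv.Perm (Fin (q / 2)) × Equiv.Perm (Fin (q / 2))) :
    (univ.filter fun w => keyOf n d q p hd I w = keyOf n d q p hd I w0).card ≤
      (∏ ℓ, ∏ v, (cnt (I ℓ) v).factorial) ^ 2 := by
  classical
  have hsub : (univ.filter fun w => keyOf n d q p hd I w = keyOf n d q p hd I w0) ⊆
      Fintype.piFinset fun ℓ =>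
        (univ.filter fun g : Equiv.Perm (Fin (q / 2)) => I ℓ ∘ g = I ℓ ∘ (w0 ℓ).1) ×ˢ
        (univ.filter fun g : Equiv.Perm (Fin (q / 2)) => I (ℓ + 1) ∘ g = I (ℓ + 1) ∘ (w0 ℓ).2) := by
    intro w hw
    simp only [mem_filter, mem_univ, true_and, Fintype.mem_piFinset, mem_product] at hw ⊢
    intro ℓ
    constructor
    · funext t
      obtain ⟨⟨m, r⟩, rfl⟩ := (blockEquiv d q hd hdq).surjective t
      have h := congrFun (congrFun hw (ℓ, m)) ⟨r, by omega⟩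
      simp only [keyOf, halfConcat_left] at h
      simpa [blockEquiv_apply] using h
    · funext t
      obtain ⟨⟨m, r⟩, rfl⟩ := (blockEquiv d q hd hdq).surjective t
      have h := congrFun (congrFun hw (ℓ, m)) ⟨d / 2 + r, by omega⟩
      simp only [keyOf, halfConcat_right] at h
      simpa [blockEquiv_apply] using h
  refine le_trans (Finset.card_le_card hsub) ?_
  rw [Fintype.card_piFinset]
  simp only [card_product]
  rw [Finset.prod_mul_distrib, sq]
  refine Nat.mul_le_mul ?_ ?_
  · exact Finset.prod_le_prod' fun ℓ _ => stab_card _ _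
  · have := Equiv.prod_comp (Equiv.addRight (1 : Fin p)) (fun ℓ => ∏ v, (cnt (I ℓ) v).factorial)
    rw [← this]
    exact Finset.prod_le_prod' fun ℓ _ => stab_card _ _

lemma Efun_le (n d q p : ℕ) (hd : d % 2 = 0) (hp : p ≠ 0) [NeZero p]
    (I : Fin p → Fin (q / 2) → Fin n) :
    Efun n d q p hd hp I ≤ (((q / 2).factorial : ℝ)⁻¹ ^ 2) ^ p *
      ((univ.filter fun w => ∀ k, Even
        (univ.filter fun x => keyOf n d q p hd I w x = k).card).card : ℝ) := by
  classical
  have h1 : Efun n d q p hd hp I = (((q / 2).factorial : ℝ)⁻¹ ^ 2) ^ p *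
      ∑ w, texp n d (fun A => ∏ x, A (keyOf n d q p hd I w x)) := by
    unfold Efun texp
    rw [← Finset.sum_div, Finset.sum_comm, ← mul_div_assoc, Finset.mul_sum]
    congr 1
    refine Finset.sum_congr rfl fun A _ => ?_
    simp only [rcSym]
    rw [Finset.prod_mul_distrib]
    simp only [prod_const, card_univ, Fintype.card_fin]
    congr 1
    simp only [← Fintype.sum_prod_type']
    rw [Fintype.prod_sum]
    refine Finset.sum_congr rfl fun w _ => ?_
    rw [Fintype.prod_prod_type]
    rfl
  rw [h1]
  refine mul_le_mul_of_nonneg_left ?_ (by positivity)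
  refine le_trans (Finset.sum_le_sum fun w _ => texp_prod n d _) ?_
  rw [Finset.sum_boole]

lemma prod_c {n h p s : ℕ} (c : Fin s → Fin p → ℕ) (I : Fin p → Fin h → Fin n) (hI : inC c I)
    (ℓ : Fin p) : ∏ v, (cnt (I ℓ) v).factorial = ∏ k, (c k ℓ).factorial := by
  obtain ⟨hcard, hc⟩ := hI
  rw [← Finset.prod_subset (Finset.subset_univ (occSet I))]
  · rw [← Finset.prod_coe_sort]
    rw [← Equiv.prod_comp ((occSet I).orderIsoOfFin hcard).toEquiv]
    refine Finset.prod_congr rfl fun k _ => ?_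
    rw [← hc k ℓ]; rfl
  · intro v _ hv
    have : cnt (I ℓ) v = 0 := by
      unfold cnt
      rw [Finset.card_eq_zero, Finset.filter_eq_empty_iff]
      intro j _ hj
      exact hv (by simp only [occSet, mem_filter, mem_univ, true_and]; exact ⟨ℓ, j, hj⟩)
    simp [this]

lemma nat_bound (n d q p : ℕ) [NeZero p] (hd2 : 2 ≤ d) (hd : d % 2 = 0) (hq : q % 2 = 0)
    (hdq : d ∣ q) (I : Fin p → Fin (q / 2) → Fin n) :
    (univ.filter fun w => ∀ k, Even
        (univ.filter fun x => keyOf n d q p hd I w x = k).card).card ≤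
      2 ^ (p * (q / d)) * ((p * (q / d)) ^ (p * (q / d) / 2) * (p * (q / 2)) ^ (p * (q / 2))) *
        ∏ ℓ, ∏ v, (cnt (I ℓ) v).factorial := by
  classical
  set P := ∏ ℓ, ∏ v, (cnt (I ℓ) v).factorial with hP
  have hPpos : 0 < P := Finset.prod_pos fun _ _ => Finset.prod_pos fun _ _ => Nat.factorial_pos _
  have h := count_main n d (keyOf n d q p hd I) (fun v => ∑ ℓ, cnt (I ℓ) v) (P ^ 2) (p * (q / 2))
    (by
      simp only [Fintype.card_prod, Fintype.card_fin]
      rw [mul_assoc, Nat.div_mul_cancel hdq]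
      have : 2 * (q / 2) = q := by omega
      calc 2 * (p * (q / 2)) = p * (2 * (q / 2)) := by ring
        _ = _ := by rw [this])
    (by omega) (key_count n d q p hd hdq I) (key_fiber n d q p hd hdq I)
  simp only [Fintype.card_prod, Fintype.card_fin] at h
  have hle : P ≤ ∏ v, (∑ ℓ, cnt (I ℓ) v).factorial := by
    rw [hP, Finset.prod_comm]
    exact Finset.prod_le_prod' fun v _ => Nat.le_of_dvd (Nat.factorial_pos _)
      (Nat.prod_factorial_dvd_factorial_sum _ _)
  have h2 := le_trans (Nat.mul_le_mul_left _ hle) h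
  refine Nat.le_of_mul_le_mul_right (h2.trans (le_of_eq ?_)) hPpos
  ring

lemma num_bound (d q p : ℕ) (hd2 : 2 ≤ d) (hq : q % 2 = 0) (hq0 : 0 < q) (hdq : d ∣ q)
    (hp : 1 ≤ p) :
    (((q / 2).factorial : ℝ)⁻¹ ^ 2) ^ p * (2 ^ (p * (q / d)) *
      (((p * (q / d) : ℕ) : ℝ) ^ (p * (q / d) / 2) * ((p * (q / 2) : ℕ) : ℝ) ^ (p * (q / 2)))) ≤
    (4 * Real.exp 1) ^ (p * q) *
          (p : ℝ) ^ ((1 / 2 + 1 / (2 * (d : ℝ))) * ((p : ℝ) * (q : ℝ))) /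
          (q : ℝ) ^ ((1 / 2 - 1 / (2 * (d : ℝ))) * ((p : ℝ) * (q : ℝ))) := by
  have hqR : (0:ℝ) < q := by exact_mod_cast hq0
  have hpR : (0:ℝ) < p := by exact_mod_cast hp
  have hdR : (0:ℝ) < d := by exact_mod_cast (by omega : 0 < d)
  have hpq1 : (1:ℝ) ≤ (p:ℝ) * q := by exact_mod_cast Nat.mul_pos hp hq0
  obtain ⟨h, rfl⟩ : ∃ h, q = 2 * h := ⟨q / 2, by omega⟩
  have hh : 0 < h := by omega
  have hhR : (0:ℝ) < h := by exact_mod_cast hh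
  have hdiv : 2 * h / 2 = h := by omega
  rw [hdiv]
  obtain ⟨b, hb⟩ := hdq
  have hbd : 2 * h / d = b := by rw [hb]; exact Nat.mul_div_cancel_left _ (by omega)
  rw [hbd]
  have hble : b ≤ 2 * h := by rw [hb]; exact Nat.le_mul_of_pos_left _ (by omega)
  have hbR : (d:ℝ) * b = ((2 * h : ℕ) : ℝ) := by exact_mod_cast hb.symm
  set q : ℕ := 2 * h with hqdef
  have hqh : (q:ℝ) = 2 * h := by simp [hqdef]
  -- factorial
  have f1 : ((h.factorial : ℝ)⁻¹ ^ 2) ^ p ≤ (2 * Real.exp 1) ^ (p * q) / (q:ℝ) ^ (p * q) := by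
    have := Real.pow_div_factorial_le_exp (h:ℝ) hhR.le h
    have e1 : (h.factorial : ℝ)⁻¹ ≤ (Real.exp 1 / h) ^ h := by
      rw [div_pow, ← Real.exp_nat_mul, mul_one, le_div_iff₀ (by positivity)]
      rwa [mul_comm, ← div_eq_mul_inv]
    calc ((h.factorial : ℝ)⁻¹ ^ 2) ^ p ≤ (((Real.exp 1 / h) ^ h) ^ 2) ^ p := by gcongr
      _ = (Real.exp 1 / h) ^ (p * q) := by rw [← pow_mul, ← pow_mul, hqdef]; congr 1; ring
      _ = _ := by
        rw [← div_pow, hqh]; congr 1; field_simp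
  have f2 : (2:ℝ) ^ (p * b) ≤ 2 ^ (p * q) :=
    pow_le_pow_right₀ (by norm_num) (Nat.mul_le_mul_left _ hble)
  have f3 : ((p * b : ℕ) : ℝ) ^ (p * b / 2) ≤
      ((p:ℝ) * q) ^ (1 / (2 * (d:ℝ)) * ((p:ℝ) * q)) := by
    calc ((p * b : ℕ) : ℝ) ^ (p * b / 2) ≤ ((p:ℝ) * q) ^ (p * b / 2) := by
          push_cast
          gcongr
      _ = ((p:ℝ) * q) ^ ((p * b / 2 : ℕ) : ℝ) := (Real.rpow_natCast _ _).symm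
      _ ≤ _ := by
          refine Real.rpow_le_rpow_of_exponent_le hpq1 ?_
          refine le_trans Nat.cast_div_le ?_
          rw [← hbR]
          push_cast
          apply le_of_eq
          field_simp
  have f4 : ((p * h : ℕ) : ℝ) ^ (p * h) ≤ ((p:ℝ) * q) ^ (1 / 2 * ((p:ℝ) * q)) := by
    calc ((p * h : ℕ) : ℝ) ^ (p * h) ≤ ((p:ℝ) * q) ^ (p * h) := by
          push_cast
          gcongr
          omega
      _ = ((p:ℝ) * q) ^ ((p * h : ℕ) : ℝ) := (Real.rpow_natCast _ _).symm
      _ = _ := by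
          congr 1
          rw [hqh]; push_cast; ring
  calc _ ≤ (2 * Real.exp 1) ^ (p * q) / (q:ℝ) ^ (p * q) * (2 ^ (p * q) *
        (((p:ℝ) * q) ^ (1 / (2 * (d:ℝ)) * ((p:ℝ) * q)) * ((p:ℝ) * q) ^ (1 / 2 * ((p:ℝ) * q)))) := by
        gcongr
    _ = _ := by
        have e4 : (4 * Real.exp 1) ^ (p * q) = (2 * Real.exp 1) ^ (p * q) * 2 ^ (p * q) := by
          rw [← mul_pow]; congr 1; ring
        rw [← Real.rpow_add (by positivity), Real.mul_rpow hpR.le hqR.le, e4,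
          ← Real.rpow_natCast (q:ℝ) (p * q)]
        have e5 : (1 / 2 - 1 / (2 * (d : ℝ))) * ((p : ℝ) * (q : ℝ)) =
          ((p * q : ℕ) : ℝ) - (1 / (2 * (d:ℝ)) * ((p:ℝ) * q) + 1 / 2 * ((p:ℝ) * q)) := by
          push_cast; ring
        have e6 : (1 / 2 + 1 / (2 * (d : ℝ))) * ((p : ℝ) * (q : ℝ)) =
          (1 / (2 * (d:ℝ)) * ((p:ℝ) * q) + 1 / 2 * ((p:ℝ) * q)) := by ring
        rw [e5, e6, Real.rpow_sub hqR]
        have hx := Real.rpow_pos_of_pos hqR ((p * q : ℕ) : ℝ)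
        have hy := Real.rpow_pos_of_pos hqR (1 / (2 * (d:ℝ)) * ((p:ℝ) * q) + 1 / 2 * ((p:ℝ) * q))
        generalize (q:ℝ) ^ ((p * q : ℕ) : ℝ) = X at *
        generalize (q:ℝ) ^ (1 / (2 * (d:ℝ)) * ((p:ℝ) * q) + 1 / 2 * ((p:ℝ) * q)) = Y at *
        field_simp

end helpers2

theorem stmt_4 : ∃ C : ℝ, 0 < C ∧
    ∀ (n d q p s : ℕ) (hd2 : 2 ≤ d) (hde : d % 2 = 0) (hqe : q % 2 = 0)
      (hdq : d ∣ q) (hp : 1 ≤ p) (hs : 1 ≤ s)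
      (c : Fin s → Fin p → ℕ) (hc : ∀ k ℓ, c k ℓ ≤ q / 2)
      (I : Fin p → Fin (q / 2) → Fin n) (hI : inC c I),
      Efun n d q p hde (by omega) I ≤
        C ^ (p * q) *
          (p : ℝ) ^ ((1 / 2 + 1 / (2 * (d : ℝ))) * ((p : ℝ) * (q : ℝ))) /
          (q : ℝ) ^ ((1 / 2 - 1 / (2 * (d : ℝ))) * ((p : ℝ) * (q : ℝ))) *
          ∏ ℓ : Fin p, ∏ k : Fin s, (Nat.factorial (c k ℓ) : ℝ) := by
  refine ⟨4 * Real.exp 1, by positivity, ?_⟩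
  intro n d q p s hd2 hde hqe hdq hp hs c hc I hI
  haveI : NeZero p := ⟨by omega⟩
  have hq0 : 0 < q := by
    rcases Nat.eq_zero_or_pos q with rfl | h
    · exfalso
      obtain ⟨hcard, -⟩ := hI
      have : occSet I = ∅ := by
        unfold occSet
        rw [Finset.filter_eq_empty_iff]
        rintro v - ⟨ℓ, j, -⟩
        exact absurd j.isLt (by simp)
      rw [this] at hcard
      simp at hcard
      omega
    · exact h
  have h1 := Efun_le n d q p hde (by omega) I
  have h2 := nat_bound n d q p hd2 hde hqe hdq I
  rw [Finset.prod_congr rfl fun ℓ _ => prod_c c I hI ℓ] at h2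
  have h3 := num_bound d q p hd2 hqe hq0 hdq hp
  have h2' := (Nat.cast_le (α := ℝ)).mpr h2
  refine h1.trans ((mul_le_mul_of_nonneg_left h2' (by positivity)).trans ?_)
  rw [Nat.cast_mul, ← mul_assoc]
  have hP : ((∏ ℓ : Fin p, ∏ k : Fin s, (c k ℓ).factorial : ℕ) : ℝ) =
      ∏ ℓ : Fin p, ∏ k : Fin s, ((c k ℓ).factorial : ℝ) := by push_cast; rfl
  rw [hP]
  refine mul_le_mul_of_nonneg_right (le_trans (le_of_eq ?_) h3) (by positivity)
  push_cast
  ring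
end

section
/- Let d ≥ 2 be even, q even with d | q, p a positive integer, and let M be the row-column independent symmetrization of A^{⊗q/d} for a random d-tensor A with i.i.d. entries uniform on {−1,+1}. For all I^1,…,I^p ∈ [n]^{q/2}: if E(I^1,…,I^p) ≠ 0, then the number N(I^1,…,I^p) of distinct elements of [n] occurring among the coordinates of I^1,…,I^p is at most pq/4 + q/2. -/
open scoped BigOperators

/-- Sign attached to a single index. -/
def eSgn {n : ℕ} (v x : Fin n) : ℝ := if x = v then -1 else 1

/-- Sign attached to a tensor index: parity of the occurrences of `v` in the first half. -/
def kSgn {n : ℕ} (d : ℕ) (v : Fin n) (K : Fin d → Fin n) : ℝ :=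
  ∏ r : Fin (d / 2), eSgn v (K ⟨r, by have := r.isLt; omega⟩)

theorem eSgn_cases {n : ℕ} (v x : Fin n) : eSgn v x = 1 ∨ eSgn v x = -1 := by
  unfold eSgn; split_ifs <;> simp

theorem kSgn_cases {n : ℕ} (d : ℕ) (v : Fin n) (K : Fin d → Fin n) :
    kSgn d v K = 1 ∨ kSgn d v K = -1 := by
  unfold kSgn
  refine Finset.prod_induction _ (fun x : ℝ => x = 1 ∨ x = -1) ?_ (Or.inl rfl) ?_
  · rintro a b (rfl | rfl) (rfl | rfl) <;> simp
  · intro r _; exact eSgn_cases _ _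

theorem prod_eSgn {n k : ℕ} (v : Fin n) (I : Fin k → Fin n) :
    ∏ j, eSgn v (I j) = (-1 : ℝ) ^ cnt I v := by
  unfold eSgn cnt
  rw [Finset.prod_ite]; simp

theorem kSgn_halfConcat {n : ℕ} (d : ℕ) (hd : d % 2 = 0) (v : Fin n)
    (K₁ K₂ : Fin (d / 2) → Fin n) :
    kSgn d v (halfConcat d hd K₁ K₂) = ∏ r, eSgn v (K₁ r) := by
  unfold kSgn halfConcat
  refine Finset.prod_congr rfl fun r _ => ?_
  simp

theorem half_mul (d q : ℕ) (hde : d % 2 = 0) (hdq : d ∣ q) (hd2 : 2 ≤ d) :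
    q / d * (d / 2) = q / 2 := by
  obtain ⟨e, rfl⟩ := Nat.dvd_of_mod_eq_zero hde
  obtain ⟨c, rfl⟩ := hdq
  have he : 0 < e := by omega
  rw [Nat.mul_div_cancel_left c (by omega), Nat.mul_div_cancel_left e (by omega),
    mul_assoc, Nat.mul_div_cancel_left _ (by omega), mul_comm]

theorem blockIdx_bij (d q : ℕ) (hd2 : 2 ≤ d) (hde : d % 2 = 0) (hdq : d ∣ q) :
    Function.Bijective (fun x : Fin (q / d) × Fin (d / 2) => blockIdx d q x.1 x.2) := by
  rw [Fintype.bijective_iff_injective_and_card]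
  refine ⟨?_, ?_⟩
  · rintro ⟨m, r⟩ ⟨m', r'⟩ h
    simp only [blockIdx, Fin.mk.injEq] at h
    have hpos : 0 < d / 2 := by omega
    have h1 := congrArg (· % (d / 2)) h
    have h2 := congrArg (· / (d / 2)) h
    simp only [Nat.mul_add_mod', Nat.mod_eq_of_lt r.isLt, Nat.mod_eq_of_lt r'.isLt] at h1
    simp only [mul_comm _ (d / 2), Nat.mul_add_div hpos, Nat.div_eq_of_lt r.isLt,
      Nat.div_eq_of_lt r'.isLt] at h2
    simp only [Prod.mk.injEq, Fin.ext_iff]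
    omega
  · simp [half_mul d q hde hdq hd2]

theorem rcSym_flip (n d q : ℕ) (hd2 : 2 ≤ d) (hde : d % 2 = 0) (hdq : d ∣ q) (v : Fin n)
    (A : (Fin d → Fin n) → ℝ) (I J : Fin (q / 2) → Fin n) :
    rcSym n d q hde (fun K => kSgn d v K * A K) I J
      = (-1) ^ cnt I v * rcSym n d q hde A I J := by
  unfold rcSym
  rw [mul_left_comm]
  congr 1
  rw [Finset.mul_sum]
  refine Finset.sum_congr rfl fun π _ => ?_
  rw [Finset.mul_sum]
  refine Finset.sum_congr rfl fun σ _ => ?_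
  rw [Finset.prod_mul_distrib]
  congr 1
  simp only [kSgn_halfConcat]
  rw [← prod_eSgn, ← Fintype.prod_prod_type' (f := fun m r => eSgn v (I (π (blockIdx d q m r)))),
    (blockIdx_bij d q hd2 hde hdq).prod_comp (fun j => eSgn v (I (π j))),
    Equiv.prod_comp π (fun j => eSgn v (I j))]

/-- Flip the Boolean pattern where the sign is `-1`. -/
noncomputable def flipB {n d : ℕ} (v : Fin n) (A : (Fin d → Fin n) → Bool) : (Fin d → Fin n) → Bool :=
  fun K => xor (A K) (@decide (kSgn d v K = -1) (Classical.propDecidable _))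

theorem flipB_invol {n d : ℕ} (v : Fin n) :
    Function.Involutive (flipB v : ((Fin d → Fin n) → Bool) → _) := by
  intro A; funext K; simp [flipB]

theorem signT_flipB {n d : ℕ} (v : Fin n) (A : (Fin d → Fin n) → Bool) :
    signT (flipB v A) = fun K => kSgn d v K * signT A K := by
  funext K
  rcases kSgn_cases d v K with h | h <;> cases hA : A K <;>
    simp [signT, flipB, h, hA] <;> norm_num

theorem texp_flip (n d : ℕ) (v : Fin n) (g : ((Fin d → Fin n) → ℝ) → ℝ) :
    texp n d (fun A => g (fun K => kSgn d v K * A K)) = texp n d g := by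
  unfold texp
  congr 1
  simp only [← signT_flipB]
  exact (flipB_invol v).bijective.sum_comp (fun A => g (signT A))

theorem Efun_flip (n d q p : ℕ) (hd2 : 2 ≤ d) (hde : d % 2 = 0) (hdq : d ∣ q) (hp : p ≠ 0)
    (v : Fin n) (I : Fin p → Fin (q / 2) → Fin n) :
    Efun n d q p hde hp I = (-1) ^ (∑ ℓ, cnt (I ℓ) v) * Efun n d q p hde hp I := by
  haveI : NeZero p := ⟨hp⟩
  conv_lhs => unfold Efun
  rw [← texp_flip n d v]
  simp only [rcSym_flip n d q hd2 hde hdq, Finset.prod_mul_distrib, Finset.prod_pow_eq_pow_sum]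
  unfold Efun texp
  rw [← Finset.mul_sum, mul_div_assoc]

theorem sum_cnt {n k : ℕ} (I : Fin k → Fin n) : ∑ v, cnt I v = k := by
  unfold cnt
  rw [← Finset.card_eq_sum_card_fiberwise (fun _ _ => Finset.mem_coe.2 (Finset.mem_univ _))]
  simp

theorem stmt_5 (n d q p : ℕ) (hd2 : 2 ≤ d) (hde : d % 2 = 0) (hqe : q % 2 = 0)
    (hdq : d ∣ q) (hp : 1 ≤ p)
    (I : Fin p → Fin (q / 2) → Fin n)
    (hne : Efun n d q p hde (by omega) I ≠ 0) :
    ((occSet I).card : ℝ) ≤ (p : ℝ) * (q : ℝ) / 4 + (q : ℝ) / 2 := by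
  have h2 : ∀ v ∈ occSet I, 2 ≤ ∑ ℓ, cnt (I ℓ) v := by
    intro v hv
    obtain ⟨ℓ, j, hj⟩ := (Finset.mem_filter.1 hv).2
    have hpos : 0 < cnt (I ℓ) v :=
      Finset.card_pos.2 ⟨j, Finset.mem_filter.2 ⟨Finset.mem_univ _, hj⟩⟩
    have hle : cnt (I ℓ) v ≤ ∑ ℓ, cnt (I ℓ) v :=
      Finset.single_le_sum (f := fun ℓ => cnt (I ℓ) v) (fun _ _ => Nat.zero_le _)
        (Finset.mem_univ ℓ)
    have hE := Efun_flip n d q p hd2 hde hdq (by omega) v I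
    rcases Nat.even_or_odd (∑ ℓ, cnt (I ℓ) v) with he | ho
    · obtain ⟨c, hc⟩ := he
      omega
    · rw [ho.neg_one_pow] at hE
      exact absurd (by linarith) hne
  have h3 : (occSet I).card * 2 ≤ p * (q / 2) := by
    calc (occSet I).card * 2 ≤ ∑ v ∈ occSet I, ∑ ℓ, cnt (I ℓ) v := by
          simpa using Finset.card_nsmul_le_sum _ _ _ h2
      _ ≤ ∑ v, ∑ ℓ, cnt (I ℓ) v := Finset.sum_le_sum_of_subset (Finset.subset_univ _)
      _ = ∑ ℓ, ∑ v, cnt (I ℓ) v := Finset.sum_comm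
      _ = p * (q / 2) := by simp [sum_cnt]
  have hq : (q : ℝ) = 2 * ((q / 2 : ℕ) : ℝ) := by
    have : q = 2 * (q / 2) := by omega
    exact_mod_cast this
  have h4 : ((occSet I).card : ℝ) * 2 ≤ p * ((q / 2 : ℕ) : ℝ) := by exact_mod_cast h3
  have hc : (0 : ℝ) ≤ ((q / 2 : ℕ) : ℝ) := Nat.cast_nonneg _
  generalize ((q / 2 : ℕ) : ℝ) = c at *
  rw [hq]
  linarith
end

section
/- For every positive integer n and every positive even integer q, there exists a matrix Ŵ, with rows and columns indexed by the set 𝒩 of multi-indices α ∈ ℕ^n with |α| = q/2, satisfying: (1) Ŵ[β,γ] = Ŵ[β',γ'] whenever β+γ = β'+γ' (degree-q SoS symmetry); (2) yᵀŴy ≥ ‖y‖₂²/2 for every y ∈ ℝ^𝒩 (minimum eigenvalue at least 1/2); (3) 0 ≤ Ŵ[β,γ] ≤ 2^q for all β,γ ∈ 𝒩. -/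
open scoped BigOperators

/-- Ballot numbers: nonnegative lattice paths from `0` to `j` in `a` steps. -/
def ballotL : ℕ → ℕ → ℕ
  | 0, 0 => 1
  | 0, _ + 1 => 0
  | a + 1, 0 => ballotL a 1
  | a + 1, j + 1 => ballotL a j + ballotL a (j + 2)

theorem ballotL_zero_of_lt (a : ℕ) : ∀ j, a < j → ballotL a j = 0 := by
  induction a with
  | zero => intro j hj; obtain ⟨j, rfl⟩ : ∃ t, j = t + 1 := ⟨j - 1, by omega⟩; rfl
  | succ a ih =>
    intro j hj
    obtain ⟨j, rfl⟩ : ∃ t, j = t + 1 := ⟨j - 1, by omega⟩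
    simp only [ballotL]
    rw [ih j (by omega), ih (j + 2) (by omega)]

theorem ballotL_self (a : ℕ) : ballotL a a = 1 := by
  induction a with
  | zero => rfl
  | succ a ih =>
    simp only [ballotL]
    rw [ih, ballotL_zero_of_lt a (a + 2) (by omega)]

theorem ballotL_le (a : ℕ) : ∀ j, ballotL a j ≤ 2 ^ a := by
  induction a with
  | zero => intro j; cases j <;> simp [ballotL]
  | succ a ih =>
    intro j
    cases j with
    | zero => simp only [ballotL]; have := ih 1; rw [pow_succ]; omega
    | succ j => simp only [ballotL]; have := ih j; have := ih (j + 2); rw [pow_succ]; omega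

theorem ballotL_shift_aux (a b N : ℕ) :
    ∑ j ∈ Finset.range (N + 1), ballotL (a + 1) j * ballotL b j + ballotL a N * ballotL b (N + 1)
      = ∑ j ∈ Finset.range (N + 1), ballotL a j * ballotL (b + 1) j
        + ballotL a (N + 1) * ballotL b N := by
  induction N with
  | zero => simp [ballotL]; ring
  | succ N ih =>
    rw [Finset.sum_range_succ, Finset.sum_range_succ _ (N + 1)]
    simp only [ballotL]
    nlinarith [ih]

theorem ballotL_conv (b : ℕ) : ∀ a N, a + b ≤ N →
    ∑ j ∈ Finset.range (N + 1), ballotL a j * ballotL b j = ballotL (a + b) 0 := by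
  induction b with
  | zero =>
    intro a N _
    rw [Finset.sum_eq_single 0]
    · simp [ballotL]
    · intro j _ hj
      rw [ballotL_zero_of_lt 0 j (by omega), mul_zero]
    · simp
  | succ b ih =>
    intro a N h
    have h1 := ballotL_shift_aux a b N
    rw [ballotL_zero_of_lt b (N + 1) (by omega), ballotL_zero_of_lt a (N + 1) (by omega),
      ih (a + 1) N (by omega)] at h1
    simp only [mul_zero, zero_mul, add_zero] at h1
    rw [← h1]; congr 1; omega

theorem ballotL_conv_fin (a b k : ℕ) (ha : a ≤ k) :
    ∑ j : Fin (k + 1), ballotL a j * ballotL b j = ballotL (a + b) 0 := by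
  rw [← ballotL_conv b a (k + (a + b)) (by omega),
    Fin.sum_univ_eq_sum_range (fun j => ballotL a j * ballotL b j)]
  apply Finset.sum_subset
  · intro x; simp only [Finset.mem_range]; omega
  · intro x _ hx
    simp only [Finset.mem_range] at hx
    rw [ballotL_zero_of_lt a x (by omega), zero_mul]

theorem stmt_7 (n q : ℕ) (hn : 0 < n) (hq : 0 < q) (hqe : q % 2 = 0) :
    ∃ W : {α : Fin n → Fin (q / 2 + 1) // ∑ i, ((α i : ℕ)) = q / 2} →
          {α : Fin n → Fin (q / 2 + 1) // ∑ i, ((α i : ℕ)) = q / 2} → ℝ,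
      (∀ β γ β' γ', (∀ i, ((β.1 i : ℕ) + (γ.1 i : ℕ)) = ((β'.1 i : ℕ) + (γ'.1 i : ℕ))) →
        W β γ = W β' γ') ∧
      (∀ y : EuclideanSpace ℝ {α : Fin n → Fin (q / 2 + 1) // ∑ i, ((α i : ℕ)) = q / 2},
        ‖y‖ ^ 2 / 2 ≤ ∑ β, ∑ γ, y β * W β γ * y γ) ∧
      (∀ β γ, 0 ≤ W β γ ∧ W β γ ≤ 2 ^ q) := by
  set k := q / 2 with hk
  let F : (Fin n → Fin (k + 1)) → (Fin n → Fin (k + 1)) → ℝ :=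
    fun β p => ∏ i, (ballotL (β i) (p i) : ℝ)
  have hF : ∀ β γ : Fin n → Fin (k + 1),
      (∏ i, (ballotL ((β i : ℕ) + (γ i : ℕ)) 0 : ℝ)) = ∑ p, F β p * F γ p := by
    intro β γ
    have : ∀ i, (ballotL ((β i : ℕ) + (γ i : ℕ)) 0 : ℝ)
        = ∑ j : Fin (k + 1), (ballotL (β i) j : ℝ) * (ballotL (γ i) j : ℝ) := by
      intro i
      rw [← ballotL_conv_fin (β i) (γ i) k (by have := (β i).isLt; omega)]
      push_cast; rfl
    simp only [this]
    rw [Finset.prod_univ_sum, Fintype.piFinset_univ]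
    simp only [F, Finset.prod_mul_distrib]
  refine ⟨fun β γ => ∏ i, (ballotL ((β.1 i : ℕ) + (γ.1 i : ℕ)) 0 : ℝ), ?_, ?_, ?_⟩
  · intro β γ β' γ' h
    simp only [h]
  · intro y
    have hsq : ∑ β, ∑ γ, y β * (∏ i, (ballotL ((β.1 i : ℕ) + (γ.1 i : ℕ)) 0 : ℝ)) * y γ
        = ∑ p, (∑ β, y β * F β.1 p) ^ 2 := by
      simp only [hF, sq, Finset.mul_sum, Finset.sum_mul]
      conv_rhs => rw [Finset.sum_comm]
      refine Finset.sum_congr rfl fun β _ => ?_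
      conv_rhs => rw [Finset.sum_comm]
      refine Finset.sum_congr rfl fun γ _ => ?_
      refine Finset.sum_congr rfl fun p _ => ?_
      ring
    have hdiag : ∀ δ : {α : Fin n → Fin (k + 1) // ∑ i, ((α i : ℕ)) = k},
        ∑ β : {α : Fin n → Fin (k + 1) // ∑ i, ((α i : ℕ)) = k}, y β * F β.1 δ.1 = y δ := by
      intro δ
      rw [Finset.sum_eq_single δ]
      · simp [F, ballotL_self]
      · intro β _ hne
        have : ∃ i, (β.1 i : ℕ) < δ.1 i := by
          by_contra! hcon
          apply hne
          have h2 := (Finset.sum_eq_sum_iff_of_le (s := Finset.univ)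
            (f := fun i => (δ.1 i : ℕ)) (g := fun i => (β.1 i : ℕ))
            (fun i _ => hcon i)).1 (δ.2.trans β.2.symm)
          apply Subtype.ext; funext i; apply Fin.ext
          exact (h2 i (Finset.mem_univ _)).symm
        obtain ⟨i, hi⟩ := this
        have : F β.1 δ.1 = 0 :=
          Finset.prod_eq_zero (Finset.mem_univ i) (by rw [ballotL_zero_of_lt _ _ hi]; simp)
        rw [this, mul_zero]
      · simp
    rw [hsq, EuclideanSpace.real_norm_sq_eq]
    have hle : ∑ δ, y δ ^ 2 ≤ ∑ p, (∑ β, y β * F β.1 p) ^ 2 := by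
      calc ∑ δ, y δ ^ 2 = ∑ δ : {α : Fin n → Fin (k + 1) // ∑ i, ((α i : ℕ)) = k},
            (fun p => (∑ β, y β * F β.1 p) ^ 2) δ.1 := by
              refine Finset.sum_congr rfl fun δ _ => ?_
              simp only [hdiag]
        _ = ∑ p ∈ Finset.univ.map (Function.Embedding.subtype _),
              (∑ β, y β * F β.1 p) ^ 2 := by rw [Finset.sum_map]; rfl
        _ ≤ _ := Finset.sum_le_sum_of_subset_of_nonneg (Finset.subset_univ _)
              (fun _ _ _ => sq_nonneg _)
    have h0 : 0 ≤ ∑ δ, y δ ^ 2 := Finset.sum_nonneg fun _ _ => sq_nonneg _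
    linarith
  · intro β γ
    refine ⟨Finset.prod_nonneg fun i _ => Nat.cast_nonneg _, ?_⟩
    calc (∏ i, (ballotL ((β.1 i : ℕ) + (γ.1 i : ℕ)) 0 : ℝ))
        ≤ ∏ i, (2 : ℝ) ^ ((β.1 i : ℕ) + (γ.1 i : ℕ)) :=
          Finset.prod_le_prod (fun i _ => Nat.cast_nonneg _)
            (fun i _ => by exact_mod_cast ballotL_le _ 0)
      _ = 2 ^ q := by
          rw [Finset.prod_pow_eq_pow_sum, Finset.sum_add_distrib, β.2, γ.2]
          congr 1; omega
end

section
/- Let k ≥ 1, index (k+1)×(k+1) matrices by {0,1,…,k}, let T be the matrix with T[i,j] = 1 if |i−j| = 1 and 0 otherwise, let e_0 be the standard basis vector with (e_0)_0 = 1, and set R_j := T^j e_0 for 0 ≤ j ≤ k. Then: (1) for all 0 ≤ i,j ≤ k, the inner product ⟨R_i, R_j⟩ equals 0 if i+j is odd, and equals the Catalan number C_{(i+j)/2} = (1/((i+j)/2 + 1))·binom(i+j, (i+j)/2) if i+j is even; (2) the matrix R = [R_0, R_1, …, R_k] is upper triangular with all diagonal entries equal to 1; (3) consequently the Hankel matrix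 H ∈ ℝ^{(k+1)×(k+1)} defined by H[i,j] := ⟨R_i, R_j⟩ is positive definite. -/
open scoped BigOperators

/-- Number of walks on the half-line `ℕ` of length `n` from `0` to `m`. -/
noncomputable def walkW : ℕ → ℕ → ℝ
  | 0, 0 => 1
  | 0, _ + 1 => 0
  | n + 1, 0 => walkW n 1
  | n + 1, m + 1 => walkW n m + walkW n (m + 2)

theorem walkW_lt (n : ℕ) : ∀ m, n < m → walkW n m = 0 := by
  induction n with
  | zero => intro m hm; cases m with
    | zero => omega
    | succ m => simp [walkW]
  | succ n ih => intro m hm; cases m with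
    | zero => omega
    | succ m => simp [walkW, ih m (by omega), ih (m + 2) (by omega)]

theorem walkW_self (n : ℕ) : walkW n n = 1 := by
  induction n with
  | zero => simp [walkW]
  | succ n ih => simp [walkW, ih, walkW_lt n (n + 2) (by omega)]

theorem walkW_odd (n : ℕ) : ∀ m, (n + m) % 2 = 1 → walkW n m = 0 := by
  induction n with
  | zero => intro m hm; cases m with
    | zero => omega
    | succ m => simp [walkW]
  | succ n ih => intro m hm; cases m with
    | zero => simp [walkW, ih 1 (by omega)]
    | succ m => simp [walkW, ih m (by omega), ih (m + 2) (by omega)]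

theorem walkW_ballot (d : ℕ) : ∀ m, walkW (2 * (d + 1) + m) m =
    ((2 * (d + 1) + m).choose (d + 1) : ℝ) - ((2 * (d + 1) + m).choose d : ℝ) := by
  induction d with
  | zero =>
    intro m
    induction m with
    | zero => norm_num [walkW]
    | succ m ih =>
      have e : walkW (2 * (0 + 1) + (m + 1)) (m + 1) =
        walkW (2 * (0 + 1) + m) m + walkW (m + 2) (m + 2) := by
        rw [show 2 * (0 + 1) + (m + 1) = (m + 2) + 1 by ring,
          show 2 * (0 + 1) + m = m + 2 by ring, walkW]
      rw [e, ih, walkW_self]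
      simp
      ring
  | succ d ihd =>
    intro m
    induction m with
    | zero =>
      have e : walkW (2 * (d + 1 + 1) + 0) 0 = walkW (2 * (d + 1) + 1) 1 := by
        rw [show 2 * (d + 1 + 1) + 0 = (2 * (d + 1) + 1) + 1 by ring, walkW]
      rw [e, ihd, show 2 * (d + 1 + 1) + 0 = (2 * (d + 1) + 1) + 1 by ring,
        Nat.choose_succ_succ (2 * (d + 1) + 1) (d + 1),
        Nat.choose_succ_succ (2 * (d + 1) + 1) d, Nat.succ_eq_add_one, Nat.succ_eq_add_one,
        Nat.choose_symm_of_eq_add (show 2 * (d + 1) + 1 = (d + 1 + 1) + (d + 1) by ring)]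
      push_cast
      ring
    | succ m ih =>
      have e : walkW (2 * (d + 1 + 1) + (m + 1)) (m + 1) =
        walkW (2 * (d + 1 + 1) + m) m + walkW (2 * (d + 1) + (m + 2)) (m + 2) := by
        rw [show 2 * (d + 1 + 1) + (m + 1) = (2 * (d + 1 + 1) + m) + 1 by ring, walkW,
          show 2 * (d + 1) + (m + 2) = 2 * (d + 1 + 1) + m by ring]
      rw [e, ih, ihd, show 2 * (d + 1 + 1) + (m + 1) = (2 * (d + 1 + 1) + m) + 1 by ring,
        show 2 * (d + 1) + (m + 2) = 2 * (d + 1 + 1) + m by ring,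
        Nat.choose_succ_succ, Nat.choose_succ_succ (2 * (d + 1 + 1) + m) d]
      push_cast
      ring

theorem walkW_catalan (d : ℕ) :
    walkW (2 * d) 0 = ((2 * d).choose d : ℝ) / ((d : ℕ) + 1) := by
  cases d with
  | zero => simp [walkW]
  | succ d =>
    have h := walkW_ballot d 0
    rw [add_zero] at h
    rw [h, eq_div_iff (by positivity)]
    have h2 := Nat.choose_succ_right_eq (2 * (d + 1)) d
    rw [show 2 * (d + 1) - d = d + 2 by omega] at h2
    have h3 : ((2 * (d + 1)).choose (d + 1) : ℝ) * (d + 1) =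
      ((2 * (d + 1)).choose d : ℝ) * (d + 2) := by exact_mod_cast h2
    push_cast
    linear_combination h3

theorem walkW_shift (i j N : ℕ) :
    ∑ t ∈ Finset.range (N + 1), walkW (i + 1) t * walkW j t =
    ∑ t ∈ Finset.range (N + 1), walkW i t * walkW (j + 1) t
      + walkW i (N + 1) * walkW j N - walkW i N * walkW j (N + 1) := by
  induction N with
  | zero => simp [walkW]
  | succ N ih =>
    rw [Finset.sum_range_succ, ih, Finset.sum_range_succ _ (N + 1)]
    simp only [walkW]
    ring

theorem walkW_inner (i : ℕ) : ∀ j N, i < N + 1 →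
    ∑ t ∈ Finset.range (N + 1), walkW i t * walkW j t = walkW (i + j) 0 := by
  induction i with
  | zero =>
    intro j N _
    rw [Finset.sum_range_succ']
    simp [walkW]
  | succ i ih =>
    intro j N h
    rw [walkW_shift, ih (j + 1) N (by omega), walkW_lt i N (by omega),
      walkW_lt i (N + 1) (by omega), show i + 1 + j = i + (j + 1) by ring]
    ring

theorem walkW_T (k : ℕ) (T : Matrix (Fin (k + 1)) (Fin (k + 1)) ℝ)
    (hT : ∀ a b : Fin (k + 1),
      T a b = if (a : ℕ) = (b : ℕ) + 1 ∨ (b : ℕ) = (a : ℕ) + 1 then 1 else 0)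
    (e0 : Fin (k + 1) → ℝ) (he0 : e0 = fun t => if t = 0 then 1 else 0) (j : ℕ) :
    j ≤ k → ∀ t : Fin (k + 1), ((T ^ j).mulVec e0) t = walkW j t := by
  induction j with
  | zero =>
    intro _ t
    rw [pow_zero, Matrix.one_mulVec, he0]
    refine Fin.cases ?_ (fun t => ?_) t <;> simp [walkW]
  | succ j ih =>
    intro hj t
    rw [pow_succ', ← Matrix.mulVec_mulVec, Matrix.mulVec, dotProduct]
    have e : ∀ b : Fin (k + 1), T t b * ((T ^ j).mulVec e0) b =
        (fun s : ℕ => (if (t : ℕ) = s + 1 then walkW j s else 0)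
          + (if s = (t : ℕ) + 1 then walkW j s else 0)) b := by
      intro b
      rw [hT, ih (by omega)]
      dsimp only
      split_ifs <;> first | omega | simp
    rw [Finset.sum_congr rfl (fun b _ => e b), Fin.sum_univ_eq_sum_range (fun s : ℕ =>
      (if (t : ℕ) = s + 1 then walkW j s else 0) + (if s = (t : ℕ) + 1 then walkW j s else 0)),
      Finset.sum_add_distrib]
    have h2 : ∑ s ∈ Finset.range (k + 1), (if s = (t : ℕ) + 1 then walkW j s else 0)
        = walkW j (t + 1) := by
      rw [Finset.sum_ite_eq']
      split_ifs with h
      · rfl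
      · rw [Finset.mem_range] at h
        rw [walkW_lt j _ (by omega)]
    rw [h2]
    have ht := t.isLt
    generalize (t : ℕ) = m at ht
    cases m with
    | zero => simp [walkW]
    | succ m =>
      have h3 : ∀ s, (m + 1 = s + 1) ↔ (m = s) := by intro s; omega
      simp only [h3, walkW]
      rw [Finset.sum_ite_eq, if_pos (Finset.mem_range.2 (by omega))]

theorem stmt_9 (k : ℕ) (hk : 1 ≤ k)
    (T : Matrix (Fin (k + 1)) (Fin (k + 1)) ℝ)
    (hT : ∀ a b : Fin (k + 1),
      T a b = if (a : ℕ) = (b : ℕ) + 1 ∨ (b : ℕ) = (a : ℕ) + 1 then 1 else 0)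
    (e0 : Fin (k + 1) → ℝ) (he0 : e0 = fun t => if t = 0 then 1 else 0)
    (R : Matrix (Fin (k + 1)) (Fin (k + 1)) ℝ)
    (hR : ∀ i j : Fin (k + 1), R i j = ((T ^ (j : ℕ)).mulVec e0) i) :
    (∀ i j : Fin (k + 1),
      (∑ t, R t i * R t j) =
        if Even ((i : ℕ) + (j : ℕ))
        then (Nat.choose ((i : ℕ) + (j : ℕ)) (((i : ℕ) + (j : ℕ)) / 2) : ℝ) /
          ((((i : ℕ) + (j : ℕ)) / 2 : ℕ) + 1)
        else 0) ∧
    (∀ i j : Fin (k + 1), (j : ℕ) < (i : ℕ) → R i j = 0) ∧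
    (∀ i : Fin (k + 1), R i i = 1) ∧
    (Matrix.of fun i j : Fin (k + 1) => ∑ t, R t i * R t j).PosDef := by
  have hW : ∀ i j : Fin (k + 1), R i j = walkW j i := fun i j => by
    rw [hR]; exact walkW_T k T hT e0 he0 j (by omega) i
  have hup : ∀ i j : Fin (k + 1), (j : ℕ) < (i : ℕ) → R i j = 0 := fun i j h => by
    rw [hW]; exact walkW_lt _ _ h
  have hdiag : ∀ i : Fin (k + 1), R i i = 1 := fun i => by rw [hW]; exact walkW_self _
  refine ⟨fun i j => ?_, hup, hdiag, ?_⟩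
  · simp only [hW]
    rw [Fin.sum_univ_eq_sum_range (fun t => walkW i t * walkW j t), walkW_inner _ _ _ i.isLt]
    split_ifs with h
    · obtain ⟨d, hd⟩ := h
      rw [hd, show d + d = 2 * d by ring, walkW_catalan, show 2 * d / 2 = d by omega]
    · exact walkW_odd _ _ (by rw [Nat.not_even_iff] at h; omega)
  · have hdet : R.det = 1 := by
      rw [Matrix.det_of_upperTriangular (fun i j h => hup i j h)]
      simp [hdiag]
    have hinj : Function.Injective R.mulVec :=
      Matrix.mulVec_injective_of_isUnit ((Matrix.isUnit_iff_isUnit_det R).2 (by simp [hdet]))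
    have := Matrix.PosDef.conjTranspose_mul_self R hinj
    convert this using 1
    ext i j
    simp [Matrix.mul_apply]
end

section
/- Let n, k ≥ 1 and let N be a real number with N ≥ 4·n·k²·2^k. Define μ : ℕ → ℝ by μ(2l) = C_l (the l-th Catalan number) and μ(2l+1) = 0, and let E be the linear functional on real polynomials in x_1,…,x_n determined on monomials by E(x^α) = (∏_{i=1}^n μ(α_i)) / N^{|α|}. Then for every 0 ≤ m ≤ n, every 0 ≤ l ≤ k, and every polynomial p in the variables x_1,…,x_m only, of degree at most l, whose sum of squared coefficients equals 1, one has E(p²) ≥ (1 − m/(2n)) / N^{2l}. -/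
open scoped BigOperators

namespace Aux10

noncomputable def C : ℕ → ℕ → ℝ
  | 0, 0 => 1
  | 0, _ + 1 => 0
  | a + 1, 0 => C a 1
  | a + 1, j + 1 => C a j + C a (j + 2)

noncomputable def D : ℕ → ℕ → ℝ
  | 0, 0 => 1
  | 0, _ + 1 => 0
  | 1, 0 => 0
  | 1, 1 => 1
  | 1, _ + 2 => 0
  | j + 2, 0 => - D j 0
  | j + 2, a + 1 => D (j + 1) a - D j (a + 1)

lemma C_zero_of_lt : ∀ a j : ℕ, a < j → C a j = 0 := by
  intro a
  induction a with
  | zero => intro j hj; obtain ⟨j, rfl⟩ := Nat.exists_eq_succ_of_ne_zero hj.ne'; simp [C]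
  | succ a ih =>
    intro j hj
    obtain ⟨j, rfl⟩ := Nat.exists_eq_succ_of_ne_zero (by omega : j ≠ 0)
    simp only [Nat.succ_eq_add_one, C]
    rw [ih _ (by omega), ih _ (by omega)]; simp

lemma C_parity : ∀ a j : ℕ, (a + j) % 2 = 1 → C a j = 0 := by
  intro a
  induction a with
  | zero => intro j hj; obtain ⟨j, rfl⟩ := Nat.exists_eq_succ_of_ne_zero (by omega : j ≠ 0); simp [C]
  | succ a ih =>
    intro j hj
    rcases j with _ | j
    · simp only [C]; exact ih _ (by omega)
    · simp only [C]
      rw [ih _ (by omega), ih _ (by omega)]; simp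

lemma C_formula : ∀ a j : ℕ, C (j + 2 * 0) j = 1 ∧ ∀ i, a = j + 2 * (i + 1) →
    C a j = (Nat.choose a (i + 1) : ℝ) - Nat.choose a i := by
  have h0 : ∀ j, C j j = 1 := by
    intro j
    induction j with
    | zero => simp [C]
    | succ j ih => simp only [C]; rw [ih, C_zero_of_lt _ _ (by omega)]; simp
  intro a
  induction a with
  | zero => intro j; refine ⟨h0 j, ?_⟩; intro i hi; omega
  | succ a ih =>
    intro j
    refine ⟨h0 j, ?_⟩
    intro i hi
    rcases j with _ | j
    · simp only [C]
      rcases i with _ | i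
      · have : a = 1 := by omega
        subst this
        rw [h0 1]; norm_num
      · rw [(ih 1).2 i (by omega)]
        have h1 : Nat.choose a (i + 2) = Nat.choose a (i + 1) := by
          rw [← Nat.choose_symm_of_eq_add (by omega : a = (i + 2) + (i + 1))]
        rw [Nat.choose_succ_succ a (i + 1), Nat.choose_succ_succ a i]
        have h2 : Nat.choose a (i + 1).succ = Nat.choose a (i + 1) := h1
        have h3 : Nat.choose a i.succ = Nat.choose a (i + 1) := rfl
        push_cast
        rw [h2, h3]; ring
    · simp only [C]
      rw [(ih j).2 i (by omega)]
      rcases i with _ | i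
      · have : a = j + 2 := by omega
        subst this
        rw [h0]; simp
      · rw [(ih (j + 2)).2 i (by omega)]
        rw [Nat.choose_succ_succ a (i + 1), Nat.choose_succ_succ a i]
        push_cast
        simp only [Nat.succ_eq_add_one]
        ring

lemma mu_eq (μ : ℕ → ℝ)
    (hμeven : ∀ l : ℕ, μ (2 * l) = (Nat.choose (2 * l) l : ℝ) / ((l : ℝ) + 1))
    (hμodd : ∀ l : ℕ, μ (2 * l + 1) = 0) (t : ℕ) : μ t = C t 0 := by
  rcases Nat.even_or_odd' t with ⟨l, rfl | rfl⟩
  · rw [hμeven]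
    rcases l with _ | l
    · simp [C]
    · rw [(C_formula _ 0).2 l (by omega)]
      have h := Nat.choose_succ_right_eq (2 * (l + 1)) l
      rw [show 2 * (l + 1) - l = l + 2 by omega] at h
      have h' : (Nat.choose (2 * (l + 1)) (l + 1) : ℝ) * (l + 1) =
        Nat.choose (2 * (l + 1)) l * (l + 2) := by exact_mod_cast h
      have : (l : ℝ) + 2 ≠ 0 := by positivity
      push_cast
      rw [show (l : ℝ) + 1 + 1 = l + 2 by ring, div_eq_iff this]
      linear_combination -h'
  · rw [hμodd, C_parity _ _ (by omega)]

def prev (f : ℕ → ℝ) : ℕ → ℝ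
  | 0 => 0
  | j + 1 => f j

lemma C_shift (f : ℕ → ℝ) (M a : ℕ) (h : a < M) :
    ∑ j ∈ Finset.range (M + 1), C (a + 1) j * f j =
      ∑ j ∈ Finset.range (M + 1), C a j * (f (j + 1) + prev f j) := by
  simp only [mul_add, Finset.sum_add_distrib]
  rw [Finset.sum_range_succ' (fun j => C (a + 1) j * f j), Finset.sum_range_succ
    (fun j => C a j * f (j + 1)), Finset.sum_range_succ' (fun j => C a j * prev f j)]
  simp only [C, prev, add_mul, Finset.sum_add_distrib]
  rw [C_zero_of_lt a M h]
  have h1 := Finset.sum_range_succ' (fun j => C a (j + 1) * f j) M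
  have h2 := Finset.sum_range_succ (fun j => C a (j + 1) * f j) M
  rw [C_zero_of_lt a (M + 1) (by omega)] at h2
  simp only [zero_add, add_assoc] at h1 h2 ⊢
  norm_num at h1 h2 ⊢
  linarith

lemma C_hankel (M : ℕ) : ∀ a b : ℕ, a ≤ M →
    ∑ j ∈ Finset.range (M + 1), C a j * C b j = C (a + b) 0 := by
  intro a
  induction a with
  | zero =>
    intro b _
    rw [Finset.sum_range_succ']
    simp [C]
  | succ a ih =>
    intro b h
    rw [C_shift _ _ _ (by omega)]
    rw [show a + 1 + b = a + (b + 1) by ring, ← ih (b + 1) (by omega)]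
    refine Finset.sum_congr rfl fun j _ => ?_
    rcases j with _ | j <;> simp [C, prev]
    left; ring

lemma C_D (M : ℕ) : ∀ a b : ℕ, a ≤ M →
    ∑ j ∈ Finset.range (M + 1), C a j * D j b = if a = b then 1 else 0 := by
  intro a
  induction a with
  | zero =>
    intro b _
    rw [Finset.sum_range_succ']
    rcases b with _ | b <;> simp [C, D]
  | succ a ih =>
    intro b h
    rw [C_shift (fun j => D j b) _ _ (by omega)]
    rcases b with _ | b
    · rw [if_neg (by omega)]
      refine Finset.sum_eq_zero fun j _ => ?_
      rcases j with _ | j <;> simp [D, prev]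
    · have := ih b (by omega)
      simp only [Nat.add_right_cancel_iff]
      rw [← this]
      refine Finset.sum_congr rfl fun j _ => ?_
      rcases j with _ | j
      · rcases b with _ | b <;> simp [D, prev]
      · simp [D, prev]

lemma D_zero_of_lt : ∀ j a : ℕ, j < a → D j a = 0 := by
  intro j
  induction j using Nat.strong_induction_on with
  | _ j ih =>
    intro a h
    obtain ⟨a, rfl⟩ := Nat.exists_eq_succ_of_ne_zero (by omega : a ≠ 0)
    rcases j with _ | _ | j
    · simp [D]
    · obtain ⟨a, rfl⟩ := Nat.exists_eq_succ_of_ne_zero (by omega : a ≠ 0)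
      simp [D]
    · simp only [Nat.succ_eq_add_one, D]
      rw [ih _ (by omega) _ (by omega), ih _ (by omega) _ (by omega)]; simp

lemma D_diag : ∀ j : ℕ, D j j = 1 ∧ D (j + 1) (j + 1) = 1 := by
  intro j
  induction j with
  | zero => simp [D]
  | succ j ih =>
    refine ⟨ih.2, ?_⟩
    simp only [D]
    rw [ih.2, D_zero_of_lt _ _ (by omega)]; simp

lemma D_sub : ∀ j : ℕ, D (j + 1) j = 0 := by
  intro j
  induction j with
  | zero => simp [D]
  | succ j ih =>
    simp only [D]
    rw [ih, D_zero_of_lt _ _ (by omega)]; simp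

lemma D_abs : ∀ j a : ℕ, |D j a| ≤ 2 ^ j := by
  intro j
  induction j using Nat.strong_induction_on with
  | _ j ih =>
    intro a
    rcases j with _ | _ | j
    · rcases a with _ | a <;> simp [D]
    · rcases a with _ | _ | a <;> simp [D]
    · have h1 := fun a => ih (j + 1) (by omega) a
      have h2 := fun a => ih j (by omega) a
      have hp : (0 : ℝ) < 2 ^ j := by positivity
      rcases a with _ | a
      · simp only [D, abs_neg]
        have := h2 0
        simp only [pow_succ]; linarith
      · simp only [D]
        have := abs_sub (D (j + 1) a) (D j (a + 1))
        have := h1 a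
        have := h2 (a + 1)
        simp only [pow_succ] at *
        linarith

/-- one-variable bound -/
lemma one_var {ι : Type*} [Fintype ι] [DecidableEq ι] (B : ι → ι → ℝ) (e f : ℝ) (hf : 0 < f)
    (hdiag : ∀ a, B a a = 1) (hoff : ∀ j a, j ≠ a → |B j a| ≤ e)
    (hef : (Fintype.card ι : ℝ) * e ≤ f) (he : 0 ≤ e) (v : ι → ℝ) :
    ∑ a, (∑ j, v j * B j a) ^ 2 ≤ (1 + f) ^ 2 * ∑ j, v j ^ 2 := by
  set S := ∑ j, v j ^ 2 with hS
  have hS0 : 0 ≤ S := Finset.sum_nonneg fun _ _ => sq_nonneg _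
  set R : ι → ι → ℝ := fun j a => if j = a then 0 else B j a with hR
  have hB : ∀ a, ∑ j, v j * B j a = v a + ∑ j, v j * R j a := by
    intro a
    have : ∀ j, v j * B j a = (if j = a then v j else 0) + v j * R j a := by
      intro j
      by_cases h : j = a
      · subst h; simp [hR, hdiag]
      · simp [hR, h]
    simp [this, Finset.sum_add_distrib]
  have hRe : ∀ j a, R j a ^ 2 ≤ e ^ 2 := by
    intro j a
    by_cases h : j = a
    · simp [hR, h]; positivity
    · simp only [hR, h, if_false]
      exact sq_le_sq' (by linarith [neg_abs_le (B j a), hoff j a h]) (by linarith [le_abs_self (B j a), hoff j a h])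
  have hrow : ∀ a, (∑ j, v j * R j a) ^ 2 ≤ S * (Fintype.card ι * e ^ 2) := by
    intro a
    refine (Finset.sum_mul_sq_le_sq_mul_sq _ _ _).trans ?_
    refine mul_le_mul_of_nonneg_left ?_ hS0
    refine (Finset.sum_le_sum fun j _ => hRe j a).trans ?_
    simp
  have hpt : ∀ a, (∑ j, v j * B j a) ^ 2 ≤ (1 + f) * v a ^ 2 + (1 + 1 / f) * (S * (Fintype.card ι * e ^ 2)) := by
    intro a
    rw [hB a]
    set w := ∑ j, v j * R j a
    have h1 := hrow a
    have h2 : (v a + w) ^ 2 ≤ (1 + f) * v a ^ 2 + (1 + 1 / f) * w ^ 2 := by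
      have : (1 + f) * v a ^ 2 + (1 + 1 / f) * w ^ 2 - (v a + w) ^ 2 = (f * v a - w) ^ 2 / f := by
        field_simp; ring
      have : 0 ≤ (f * v a - w) ^ 2 / f := by positivity
      linarith
    have h3 : (1 + 1 / f) * w ^ 2 ≤ (1 + 1 / f) * (S * (Fintype.card ι * e ^ 2)) :=
      mul_le_mul_of_nonneg_left h1 (by positivity)
    linarith
  refine (Finset.sum_le_sum fun a _ => hpt a).trans ?_
  rw [Finset.sum_add_distrib, ← Finset.mul_sum, ← hS]
  simp only [Finset.sum_const, Finset.card_univ, nsmul_eq_mul]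
  have h4 : ((Fintype.card ι : ℝ) * e) ^ 2 ≤ f ^ 2 := by
    apply pow_le_pow_left₀ (by positivity) hef
  have h5 : (Fintype.card ι : ℝ) * ((1 + 1 / f) * (S * (Fintype.card ι * e ^ 2))) =
     (1 + 1 / f) * S * ((Fintype.card ι : ℝ) * e) ^ 2 := by ring
  rw [h5]
  have h6 : (1 + 1 / f) * S * ((Fintype.card ι : ℝ) * e) ^ 2 ≤ (1 + 1 / f) * S * f ^ 2 :=
    mul_le_mul_of_nonneg_left h4 (by positivity)
  have h7 : (1 + 1 / f) * S * f ^ 2 = (f + f ^ 2) * S := by field_simp; ring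
  nlinarith

lemma tensor {ι : Type*} [Fintype ι] (B : ι → ι → ℝ) (R : ℝ) (hR : 0 ≤ R)
    (hB : ∀ v : ι → ℝ, ∑ a, (∑ j, v j * B j a) ^ 2 ≤ R * ∑ j, v j ^ 2) (n : ℕ) :
    ∀ v : (Fin n → ι) → ℝ, ∑ α : Fin n → ι, (∑ γ, v γ * ∏ i, B (γ i) (α i)) ^ 2 ≤ R ^ n * ∑ γ, v γ ^ 2 := by
  induction n with
  | zero => intro v; simp
  | succ n ih =>
    intro v
    have key : ∀ F : (Fin (n + 1) → ι) → ℝ, ∑ γ, F γ = ∑ a : ι, ∑ γ : Fin n → ι, F (Fin.cons a γ) := by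
      intro F
      rw [← Fintype.sum_prod_type' (fun a γ => F (Fin.cons a γ))]
      exact (Fintype.sum_equiv (Fin.consEquiv (fun _ => ι)) _ _ (fun x => rfl)).symm
    simp only [key, Fin.prod_univ_succ, Fin.cons_zero, Fin.cons_succ]
    have h1 : ∀ a : ι, ∑ α : Fin n → ι, (∑ j, ∑ γ : Fin n → ι, v (Fin.cons j γ) * (B j a * ∏ i, B (γ i) (α i))) ^ 2
        ≤ R ^ n * ∑ γ : Fin n → ι, (∑ j, v (Fin.cons j γ) * B j a) ^ 2 := by
      intro a
      refine le_trans (le_of_eq ?_) (ih (fun γ => ∑ j, v (Fin.cons j γ) * B j a))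
      refine Finset.sum_congr rfl fun α _ => ?_
      rw [Finset.sum_comm]
      congr 1
      refine Finset.sum_congr rfl fun γ _ => ?_
      rw [Finset.sum_mul]
      refine Finset.sum_congr rfl fun j _ => ?_
      ring
    refine (Finset.sum_le_sum fun a _ => h1 a).trans ?_
    rw [← Finset.mul_sum, Finset.sum_comm, pow_succ, mul_assoc]
    refine mul_le_mul_of_nonneg_left ?_ (pow_nonneg hR n)
    rw [Finset.sum_comm (f := fun a γ => v (Fin.cons a γ) ^ 2), Finset.mul_sum]
    exact Finset.sum_le_sum fun γ _ => hB _

/-- main quadratic form bound -/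
lemma main_bound (n k l : ℕ) (N f : ℝ) (hN : 1 ≤ N) (hf : 0 < f)
    (hfe : ((k : ℝ) + 1) * (2 ^ k / N ^ 2) ≤ f)
    (c : (Fin n → Fin (k + 1)) → ℝ) (hc : ∀ α, l < ∑ i, (α i : ℕ) → c α = 0) :
    ∑ α, c α ^ 2 ≤ ((1 + f) ^ 2) ^ n * (N ^ (2 * l) *
      ∑ α, ∑ β, c α * c β * ((∏ i, C ((α i : ℕ) + (β i : ℕ)) 0) /
        N ^ (∑ i, ((α i : ℕ) + (β i : ℕ))))) := by
  have hN0 : N ≠ 0 := by positivity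
  have hNp : 0 < N := by positivity
  set h : (Fin n → Fin (k + 1)) → ℝ := fun γ => ∑ α, c α * ∏ i, (C (α i) (γ i) / N ^ (α i : ℕ)) with hh
  have e1 : ∑ α, ∑ β, c α * c β * ((∏ i, C ((α i : ℕ) + (β i : ℕ)) 0) /
        N ^ (∑ i, ((α i : ℕ) + (β i : ℕ)))) = ∑ γ, h γ ^ 2 := by
    have s1 : ∀ α β : Fin n → Fin (k + 1), (∏ i, C ((α i : ℕ) + (β i : ℕ)) 0) /
        N ^ (∑ i, ((α i : ℕ) + (β i : ℕ))) = ∑ γ : Fin n → Fin (k + 1),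
          (∏ i, (C (α i) (γ i) / N ^ (α i : ℕ))) * ∏ i, (C (β i) (γ i) / N ^ (β i : ℕ)) := by
      intro α β
      rw [← Finset.prod_pow_eq_pow_sum, ← Finset.prod_div_distrib]
      simp only [← Finset.prod_mul_distrib]
      rw [← Fintype.piFinset_univ, ← Finset.prod_univ_sum (fun _ => Finset.univ)
        (fun i (j : Fin (k + 1)) => C (α i) j / N ^ (α i : ℕ) * (C (β i) j / N ^ (β i : ℕ)))]
      refine Finset.prod_congr rfl fun i _ => ?_
      rw [← C_hankel k _ _ (by have := (α i).isLt; omega),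
        ← Fin.sum_univ_eq_sum_range (fun j => C (α i) j * C (β i) j), Finset.sum_div]
      refine Finset.sum_congr rfl fun j _ => ?_
      rw [pow_add, div_mul_div_comm]
    have s2 : ∀ γ, h γ ^ 2 = ∑ α, ∑ β, c α * c β *
        ((∏ i, (C (α i) (γ i) / N ^ (α i : ℕ))) * ∏ i, (C (β i) (γ i) / N ^ (β i : ℕ))) := by
      intro γ
      simp only [hh]
      rw [sq, Finset.sum_mul_sum]
      refine Finset.sum_congr rfl fun α _ => Finset.sum_congr rfl fun β _ => ?_
      ring
    simp only [s1, s2, Finset.mul_sum]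
    conv_rhs => rw [Finset.sum_comm]
    refine Finset.sum_congr rfl fun α _ => ?_
    rw [Finset.sum_comm]
  rw [e1]
  set B : Fin (k + 1) → Fin (k + 1) → ℝ := fun j a => D j a * N ^ (a : ℕ) / N ^ (j : ℕ) with hBdef
  set v : (Fin n → Fin (k + 1)) → ℝ := fun γ => h γ * ∏ i, N ^ (γ i : ℕ) with hv
  have e2 : ∀ α, c α = ∑ γ, v γ * ∏ i, B (γ i) (α i) := by
    intro α
    have t1 : ∀ γ, v γ * ∏ i, B (γ i) (α i) =
        ∑ β, c β * ∏ i, (C (β i) (γ i) * D (γ i) (α i) * (N ^ (α i : ℕ) / N ^ (β i : ℕ))) := by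
      intro γ
      simp only [hv, hh]
      rw [mul_assoc, ← Finset.prod_mul_distrib, Finset.sum_mul]
      refine Finset.sum_congr rfl fun β _ => ?_
      rw [mul_assoc, ← Finset.prod_mul_distrib]
      congr 1
      refine Finset.prod_congr rfl fun i _ => ?_
      simp only [hBdef]
      field_simp
    simp only [t1]
    rw [Finset.sum_comm]
    have t2 : ∀ β : Fin n → Fin (k + 1), ∑ γ : Fin n → Fin (k + 1),
        c β * ∏ i, (C (β i) (γ i) * D (γ i) (α i) * (N ^ (α i : ℕ) / N ^ (β i : ℕ))) =
        if β = α then c β else 0 := by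
      intro β
      rw [← Finset.mul_sum, ← Fintype.piFinset_univ, ← Finset.prod_univ_sum (fun _ => Finset.univ)
        (fun i (j : Fin (k + 1)) => C (β i) j * D j (α i) * (N ^ (α i : ℕ) / N ^ (β i : ℕ)))]
      have t3 : ∀ i, ∑ j : Fin (k + 1), C (β i) j * D j (α i) * (N ^ (α i : ℕ) / N ^ (β i : ℕ)) =
          if β i = α i then 1 else 0 := by
        intro i
        rw [← Finset.sum_mul, Fin.sum_univ_eq_sum_range (fun j => C (β i) j * D j (α i)),
          C_D k _ _ (by have := (β i).isLt; omega)]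
        by_cases hq : β i = α i
        · rw [hq]; simp [hN0]
        · have : ((β i : ℕ)) ≠ α i := fun hx => hq (Fin.ext hx)
          simp [hq, this]
      simp only [t3]
      by_cases hq : β = α
      · subst hq; simp
      · obtain ⟨i, hi⟩ := Function.ne_iff.mp hq
        rw [if_neg hq, Finset.prod_eq_zero (Finset.mem_univ i) (by simp [hi]), mul_zero]
    simp [t2]
  have hBound : ∀ w : Fin (k + 1) → ℝ, ∑ a, (∑ j, w j * B j a) ^ 2 ≤ (1 + f) ^ 2 * ∑ j, w j ^ 2 := by
    intro w
    refine one_var B (2 ^ k / N ^ 2) f hf ?_ ?_ ?_ (by positivity) w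
    · intro a; simp [hBdef, (D_diag a).1, hN0]
    · intro j a hja
      simp only [hBdef]
      have hne : (j : ℕ) ≠ a := fun hx => hja (Fin.ext hx)
      rcases lt_or_gt_of_ne hne with hlt | hgt
      · rw [D_zero_of_lt _ _ hlt]; simp; positivity
      · by_cases h1 : (j : ℕ) = a + 1
        · rw [h1, D_sub]; simp; positivity
        · obtain ⟨d, hd⟩ : ∃ d, (j : ℕ) = a + 2 + d := ⟨j - (a + 2), by omega⟩
          have hD : |D j a| ≤ 2 ^ k := (D_abs j a).trans
            (pow_le_pow_right₀ (by norm_num) (by have := j.isLt; omega))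
          have hr : D j a * N ^ (a : ℕ) / N ^ (j : ℕ) = D j a / (N ^ 2 * N ^ d) := by
            rw [show N ^ (j : ℕ) = N ^ (a : ℕ) * (N ^ 2 * N ^ d) by rw [hd]; ring]
            field_simp
          rw [hr, abs_div, abs_of_pos (by positivity : 0 < N ^ 2 * N ^ d)]
          have hone : 1 ≤ N ^ d := one_le_pow₀ hN
          refine div_le_div₀ (by positivity) hD (by positivity) ?_
          nlinarith [sq_nonneg N]
    · simpa using hfe
  have hT := tensor B _ (by positivity) hBound n v
  simp only [← e2] at hT
  refine hT.trans (mul_le_mul_of_nonneg_left ?_ (by positivity))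
  rw [Finset.mul_sum]
  refine Finset.sum_le_sum fun γ _ => ?_
  by_cases hγ : ∑ i, (γ i : ℕ) ≤ l
  · simp only [hv]
    rw [Finset.prod_pow_eq_pow_sum, mul_pow, mul_comm, ← pow_mul]
    refine mul_le_mul_of_nonneg_right ?_ (sq_nonneg _)
    exact pow_le_pow_right₀ hN (by omega)
  · have h0 : h γ = 0 := by
      simp only [hh]
      refine Finset.sum_eq_zero fun α _ => ?_
      by_cases hα : l < ∑ i, (α i : ℕ)
      · rw [hc α hα, zero_mul]
      · have : ∃ i, (α i : ℕ) < γ i := by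
          by_contra hcon
          push Not at hcon
          have := Finset.sum_le_sum (fun i (_ : i ∈ Finset.univ) => hcon i)
          omega
        obtain ⟨i, hi⟩ := this
        rw [Finset.prod_eq_zero (Finset.mem_univ i) (by rw [C_zero_of_lt _ _ hi, zero_div]), mul_zero]
    simp [hv, h0]

end Aux10

theorem stmt_10 (n k : ℕ) (hn : 1 ≤ n) (hk : 1 ≤ k) (N : ℝ)
    (hN : 4 * (n : ℝ) * (k : ℝ) ^ 2 * 2 ^ k ≤ N)
    (μ : ℕ → ℝ)
    (hμeven : ∀ l : ℕ, μ (2 * l) = (Nat.choose (2 * l) l : ℝ) / ((l : ℝ) + 1))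
    (hμodd : ∀ l : ℕ, μ (2 * l + 1) = 0)
    (E : MvPolynomial (Fin n) ℝ →ₗ[ℝ] ℝ)
    (hE : ∀ α : Fin n →₀ ℕ,
      E (MvPolynomial.monomial α 1) = (∏ i, μ (α i)) / N ^ (∑ i, α i)) :
    ∀ (m l : ℕ), m ≤ n → l ≤ k →
      ∀ p : MvPolynomial (Fin n) ℝ,
        (∀ α ∈ p.support, ∀ i : Fin n, m ≤ (i : ℕ) → α i = 0) →
        p.totalDegree ≤ l →
        (∑ α ∈ p.support, p.coeff α ^ 2) = 1 →
        (1 - (m : ℝ) / (2 * (n : ℝ))) / N ^ (2 * l) ≤ E (p * p) := by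
  intro m l hm hl p hsupp hdeg hsum
  have hn1 : (1 : ℝ) ≤ n := by exact_mod_cast hn
  have hk1 : (1 : ℝ) ≤ k := by exact_mod_cast hk
  have h2k : (2 : ℝ) ≤ 2 ^ k := by
    calc (2 : ℝ) = 2 ^ 1 := by norm_num
      _ ≤ 2 ^ k := pow_le_pow_right₀ (by norm_num) hk
  have hN8 : 8 * (n : ℝ) ≤ N := by
    refine le_trans ?_ hN
    have hk2 : (1 : ℝ) ≤ (k : ℝ) ^ 2 := one_le_pow₀ hk1
    have : (2 : ℝ) ≤ (k : ℝ) ^ 2 * 2 ^ k := by nlinarith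
    nlinarith
  have hN1 : 1 ≤ N := by linarith
  have hNp : 0 < N := by linarith
  rcases Nat.eq_zero_or_pos m with rfl | hm0
  · -- constant polynomial
    have hs : ∀ α ∈ p.support, α = 0 := by
      intro α hα; ext i; exact hsupp α hα i (Nat.zero_le _)
    have hp : p = MvPolynomial.monomial 0 (p.coeff 0) := by
      ext α
      rw [MvPolynomial.coeff_monomial]
      by_cases h0 : (0 : Fin n →₀ ℕ) = α
      · rw [if_pos h0, h0]
      · rw [if_neg h0]
        by_contra hne
        exact h0 (hs α (MvPolynomial.mem_support_iff.mpr hne)).symm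
    have hc : p.coeff 0 ^ 2 = 1 := by
      rw [← hsum]
      symm
      rw [Finset.sum_subset (s₂ := {0})]
      · simp
      · intro α hα; simp [hs α hα]
      · intro α _ hα; simp [MvPolynomial.notMem_support_iff.mp hα]
    have hμ0 : μ 0 = 1 := by have := hμeven 0; simpa using this
    have : E (p * p) = 1 := by
      rw [hp, MvPolynomial.monomial_mul, ← sq, hc, add_zero, hE]
      simp [hμ0]
    rw [this]
    simp only [Nat.cast_zero, zero_div, sub_zero]
    exact div_le_one_of_le₀ (one_le_pow₀ hN1) (by positivity)
  · set φ : (Fin n → Fin (k + 1)) → (Fin n →₀ ℕ) :=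
      fun α => Finsupp.equivFunOnFinite.symm (fun i => (α i : ℕ)) with hφ
    have hφa : ∀ α i, φ α i = (α i : ℕ) := fun α i => rfl
    have hinj : Function.Injective φ := by
      intro α β h
      funext i
      apply Fin.ext
      rw [← hφa, ← hφa, h]
    have hdeg' : ∀ s ∈ p.support, ∑ i, s i ≤ l := by
      intro s hs
      have := MvPolynomial.le_totalDegree hs
      rw [Finsupp.sum_fintype _ _ (by simp)] at this
      exact this.trans hdeg
    have hsub : p.support ⊆ Finset.univ.image φ := by
      intro s hs
      have hle : ∀ i, s i < k + 1 := by
        intro i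
        have h1 := hdeg' s hs
        have h2 := Finset.single_le_sum (f := fun i => s i) (fun _ _ => Nat.zero_le _) (Finset.mem_univ i)
        omega
      refine Finset.mem_image.mpr ⟨fun i => ⟨s i, hle i⟩, Finset.mem_univ _, ?_⟩
      ext i; rfl
    set c : (Fin n → Fin (k + 1)) → ℝ := fun α => p.coeff (φ α) with hcdef
    have hc : ∀ α, l < ∑ i, (α i : ℕ) → c α = 0 := by
      intro α hα
      by_contra hne
      have := hdeg' (φ α) (MvPolynomial.mem_support_iff.mpr hne)
      simp only [hφa] at this
      omega
    have hsum' : ∑ α, c α ^ 2 = 1 := by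
      rw [← hsum, Finset.sum_subset hsub, Finset.sum_image (fun a _ b _ h => hinj h)]
      intro s _ hs
      simp [MvPolynomial.notMem_support_iff.mp hs]
    have hp : p = ∑ α, c α • MvPolynomial.monomial (φ α) (1 : ℝ) := by
      conv_lhs => rw [MvPolynomial.as_sum p]
      rw [Finset.sum_subset hsub, Finset.sum_image (fun a _ b _ h => hinj h)]
      · refine Finset.sum_congr rfl fun α _ => ?_
        rw [MvPolynomial.smul_monomial]; simp [hcdef]
      · intro s _ hs
        simp [MvPolynomial.notMem_support_iff.mp hs]
    have hEp : E (p * p) = ∑ α, ∑ β, c α * c β * ((∏ i, Aux10.C ((α i : ℕ) + (β i : ℕ)) 0) /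
        N ^ (∑ i, ((α i : ℕ) + (β i : ℕ)))) := by
      rw [hp, Finset.sum_mul_sum]
      simp only [map_sum]
      refine Finset.sum_congr rfl fun α _ => Finset.sum_congr rfl fun β _ => ?_
      rw [smul_mul_smul_comm, MvPolynomial.monomial_mul, mul_one, map_smul, hE, smul_eq_mul]
      simp only [Finsupp.add_apply, hφa, Aux10.mu_eq μ hμeven hμodd]
    set f : ℝ := 1 / (16 * (n : ℝ) ^ 2) with hf
    have hnp : (0 : ℝ) < n := by linarith
    have hfp : 0 < f := by positivity
    have hfe : ((k : ℝ) + 1) * (2 ^ k / N ^ 2) ≤ f := by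
      rw [hf, ← mul_div_assoc, div_le_div_iff₀ (by positivity) (by positivity), one_mul]
      have a1 : ((k : ℝ) + 1) * 2 ^ k * (2 * n) ≤ N := by
        refine le_trans ?_ hN
        have : (k : ℝ) + 1 ≤ 2 * (k : ℝ) ^ 2 := by nlinarith
        calc ((k : ℝ) + 1) * 2 ^ k * (2 * n) ≤ (2 * (k : ℝ) ^ 2) * 2 ^ k * (2 * n) := by gcongr
          _ = _ := by ring
      calc ((k : ℝ) + 1) * 2 ^ k * (16 * n ^ 2) = (((k : ℝ) + 1) * 2 ^ k * (2 * n)) * (8 * n) := by ring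
        _ ≤ N * N := by gcongr
        _ = N ^ 2 := by ring
    have hmain := Aux10.main_bound n k l N f hN1 hfp hfe c hc
    rw [hsum', ← hEp] at hmain
    rw [div_le_iff₀ (by positivity), mul_comm (E (p * p))]
    set X := N ^ (2 * l) * E (p * p) with hX
    have hf1 : f ≤ 1 := by
      rw [hf]; refine div_le_one_of_le₀ ?_ (by positivity); nlinarith
    have hbern := one_add_mul_le_pow (a := -f) (by linarith) (2 * n)
    have hprod : ((1 + f) ^ 2) ^ n * (1 + -f) ^ (2 * n) ≤ 1 := by
      rw [← pow_mul, ← mul_pow]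
      refine pow_le_one₀ ?_ ?_ <;> nlinarith
    have hP : 0 < ((1 + f) ^ 2) ^ n := by positivity
    have hX1 : (1 + -f) ^ (2 * n) ≤ X := by
      have : ((1 + f) ^ 2) ^ n * (1 + -f) ^ (2 * n) ≤ ((1 + f) ^ 2) ^ n * X := hprod.trans hmain
      exact le_of_mul_le_mul_left this hP
    refine le_trans ?_ hX1
    refine le_trans ?_ hbern
    have hm1 : (1 : ℝ) ≤ m := by exact_mod_cast hm0
    have b1 : (1 : ℝ) / (2 * n) ≤ m / (2 * n) := by gcongr
    have b2 : 2 * (n : ℝ) * f ≤ 1 / (2 * n) := by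
      rw [hf, le_div_iff₀ (by positivity)]
      field_simp
      norm_num
    push_cast
    linarith
end
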